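/- Let m ≥ 2, k ≥ 0 and d ≥ 2 be integers. In the polynomial ring (ℤ/2)[x₁,...,x_m], for a nonempty subset S ⊆ {1,...,m} let ℓ_S denote the linear form Σ_{i∈S} x_i, and consider the polynomial Q = (Π_{i=2}^m x_i^k) · (Π_{S ⊆ {1,...,m}, |S| ≥ 2} ℓ_S)^{k+1} (this equals (1/(x₂x₃⋯x_m))·(𝔓_m/x₁)^{k+1}, where 𝔓_m = Π_{∅≠S⊆{1,...,m}} ℓ_S is the Dickson polynomial). If Q does not belong to the ideal of (ℤ/2)[x₁,...,x_m] generated by x₁^d, x₂^d, ..., x_m^d, then every mass distribution μ on ℝ^d admits an equipartition into (2k+2)×2×⋯×2 boxes (with m-1 factors of 2) by a collection of 2k+1 parallel hyperplanes orthogonal to some unit vector u₁ at levels t_1 < ... < t_{2k+1}, together with m-1 additional hyperplanes orthogonal to unit vectors u₂,...,u_m at levels s₂,...,s_m, the vectors u₁,...,u_m being pairwise non-parallel: each of the 2^{m-1}(2k+2) regions {x : t_i < ⟨x,u₁⟩ < t_{i+1}} ∩ ∩_{j=2}^m {x : ⟨x,u_j⟩ ≶ s_j} (with t_0 = -∞,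 t_{2k+2} = +∞ and every choice of sign for each j) has μ-measure μ(ℝ^d)/(2^{m-1}(2k+2)). -/

import Mathlib

open MeasureTheory

/-- The open slab between consecutive parallel hyperplanes orthogonal to `u`:
for `0 ≤ i ≤ n`, the region `{x : t i < ⟪x,u⟫ < t (i+1)}`, with the conventions
`t 0 = -∞` and `t (n+1) = +∞` (i.e. the corresponding inequality is dropped). -/
noncomputable def slab {d : ℕ} (u : EuclideanSpace ℝ (Fin d)) (t : ℕ → ℝ) (n i : ℕ) :
    Set (EuclideanSpace ℝ (Fin d)) :=
  {x | (1 ≤ i → t i < (inner ℝ x u : ℝ)) ∧ (i + 1 ≤ n → (inner ℝ x u : ℝ) < t (i + 1))}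

/-- The open halfspace below (`b = true`) or above (`b = false`) the hyperplane
orthogonal to `v` at level `s`. -/
def halfSp {d : ℕ} (v : EuclideanSpace ℝ (Fin d)) (s : ℝ) (b : Bool) :
    Set (EuclideanSpace ℝ (Fin d)) :=
  if b then {x | (inner ℝ x v : ℝ) < s} else {x | s < (inner ℝ x v : ℝ)}



namespace EqP

open Function

/-- Combinatorial model of a sphere with antipodal action, mod 2. -/
structure Cx (P : Type) [Fintype P] where
  e : P → P → ZMod 2
  neg : P → P
  L : P → ZMod 2
  lam : P → ZMod 2
  top : P → ZMod 2
  D : ℕ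
  neg_neg : ∀ p, neg (neg p) = p
  e_neg : ∀ p q, e (neg p) (neg q) = e p q
  top_neg : ∀ p, top (neg p) = top p
  L_neg : ∀ p, L (neg p) = L p + 1
  e_sq : ∀ a c, ∑ b, e a b * e b c = 0
  e_top : ∀ a, ∑ b, e a b * top b = 0
  lam_e : ∀ p, ∑ q, lam q * e q (neg p) = ∑ q, lam q * e q p
  val : ∀ n, ∑ p, lam p * ((fun (u : P → ZMod 2) p => ∑ w, e p w * (L p + L w) * u w)^[n] top) p
    = if n = D then 1 else 0

section abs
variable {P : Type} [Fintype P] (K : Cx P) {m : ℕ}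

theorem two_add (a : ZMod 2) : a + a = 0 := CharTwo.add_self_eq_zero a

def opA (y : (Fin m → P) → ZMod 2) : (Fin m → P) → ZMod 2 :=
  fun v => ∑ i, ∑ w, K.e (v i) w * y (update v i w)

def opX (h y : (Fin m → P) → ZMod 2) : (Fin m → P) → ZMod 2 :=
  h * opA K y + opA K (h * y)

def flip (i : Fin m) (v : Fin m → P) : Fin m → P := update v i (K.neg (v i))

def Inv (y : (Fin m → P) → ZMod 2) : Prop := ∀ i v, y (flip K i v) = y v

theorem opA_add (y z : (Fin m → P) → ZMod 2) : opA K (y + z) = opA K y + opA K z := by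
  funext v
  simp only [opA, Pi.add_apply, mul_add, Finset.sum_add_distrib]

theorem opA_smul (c : ZMod 2) (y : (Fin m → P) → ZMod 2) :
    opA K (fun v => c * y v) = fun v => c * opA K y v := by
  funext v
  simp only [opA, Finset.mul_sum]
  refine Finset.sum_congr rfl fun i _ => Finset.sum_congr rfl fun w _ => ?_
  ring

theorem opA_zero : opA K (0 : (Fin m → P) → ZMod 2) = 0 := by
  funext v; simp [opA]

theorem fun_two_add (y : (Fin m → P) → ZMod 2) : y + y = 0 := by
  funext v; exact two_add _

theorem opA_opA (y : (Fin m → P) → ZMod 2) : opA K (opA K y) = 0 := by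
  funext v
  have h1 : opA K (opA K y) v = ∑ p : Fin m × Fin m, ∑ w, ∑ w',
      K.e (v p.1) w * (K.e ((update v p.1 w) p.2) w' * y (update (update v p.1 w) p.2 w')) := by
    simp only [opA, Finset.mul_sum]
    rw [Fintype.sum_prod_type]
    refine Finset.sum_congr rfl fun i _ => ?_
    rw [Finset.sum_comm]
  rw [h1]
  have hdiag : ∀ i : Fin m, ∑ w, ∑ w',
      K.e (v i) w * (K.e ((update v i w) i) w' * y (update (update v i w) i w')) = 0 := by
    intro i
    rw [Finset.sum_comm]
    simp only [update_self, update_idem]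
    apply Finset.sum_eq_zero
    intro w' _
    have := K.e_sq (v i) w'
    calc _ = (∑ b, K.e (v i) b * K.e b w') * y (update v i w') := by
          rw [Finset.sum_mul]
          refine Finset.sum_congr rfl fun w _ => ?_
          ring
      _ = 0 := by rw [this, zero_mul]
  refine Finset.sum_involution (fun p _ => (p.2, p.1)) ?_ ?_ (by simp) (by simp)
  · rintro ⟨i, j⟩ _
    by_cases hij : i = j
    · subst hij
      simp only [hdiag, add_zero]
    · simp only
      rw [Finset.sum_comm (γ := P)]
      have : ∀ w w', K.e (v i) w' * (K.e ((update v i w') j) w * y (update (update v i w') j w))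
        = K.e (v j) w * (K.e ((update v j w) i) w' * y (update (update v j w) i w')) := by
        intro w w'
        rw [update_of_ne (Ne.symm hij), update_of_ne hij, update_comm hij]
        ring
      simp only [this]
      exact two_add _
  · rintro ⟨i, j⟩ _ hne heq
    simp only [Prod.mk.injEq] at heq
    obtain ⟨h, _⟩ := heq
    subst h
    exact hne (hdiag j)

theorem opA_opX (h y : (Fin m → P) → ZMod 2) : opA K (opX K h y) = opX K h (opA K y) := by
  unfold opX
  rw [opA_add, opA_opA, opA_opA]
  simp

theorem opX_add_right (h y z : (Fin m → P) → ZMod 2) :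
    opX K h (y + z) = opX K h y + opX K h z := by
  unfold opX
  rw [mul_add, opA_add, opA_add]
  ring

theorem opX_add_left (h c y : (Fin m → P) → ZMod 2) :
    opX K (h + c) y = opX K h y + opX K c y := by
  unfold opX
  rw [add_mul, add_mul, opA_add]
  ring

theorem opX_zero_left (y : (Fin m → P) → ZMod 2) :
    opX K 0 y = 0 := by
  unfold opX
  rw [zero_mul, zero_mul, opA_zero, add_zero]

theorem opX_sum_left {ι : Type} (s : Finset ι) (f : ι → (Fin m → P) → ZMod 2)
    (y : (Fin m → P) → ZMod 2) :
    opX K (∑ i ∈ s, f i) y = ∑ i ∈ s, opX K (f i) y := by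
  classical
  induction s using Finset.induction_on with
  | empty => simp [opX_zero_left]
  | insert a s ha ih => rw [Finset.sum_insert ha, Finset.sum_insert ha, opX_add_left, ih]

theorem opX_const (c : ZMod 2) (y : (Fin m → P) → ZMod 2) :
    opX K (fun _ => c) y = 0 := by
  unfold opX
  have : ((fun _ => c) * y : (Fin m → P) → ZMod 2) = fun v => c * y v := rfl
  rw [this, opA_smul]
  exact fun_two_add _

theorem flip_flip (i : Fin m) (v : Fin m → P) : flip K i (flip K i v) = v := by
  simp [flip, K.neg_neg]

theorem opA_flip (i : Fin m) (y : (Fin m → P) → ZMod 2) (v : Fin m → P) :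
    opA K y (flip K i v) = opA K (fun v => y (flip K i v)) v := by
  unfold opA
  refine Finset.sum_congr rfl fun j _ => ?_
  by_cases hij : j = i
  · subst hij
    refine Fintype.sum_equiv ⟨K.neg, K.neg, K.neg_neg, K.neg_neg⟩ _ _ fun w => ?_
    simp only [flip, update_self, Equiv.coe_fn_mk, update_idem, K.neg_neg]
    rw [← K.e_neg, K.neg_neg]
  · refine Finset.sum_congr rfl fun w _ => ?_
    simp only [flip]
    rw [update_of_ne hij, update_of_ne (Ne.symm hij), update_comm hij]

theorem Inv.opA {y : (Fin m → P) → ZMod 2} (hy : Inv K y) : Inv K (opA K y) := by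
  intro i v
  rw [opA_flip]
  congr 1
  funext v
  exact hy i v

theorem Inv.opX {h y : (Fin m → P) → ZMod 2} (c : Fin m → ZMod 2)
    (hh : ∀ i v, h (flip K i v) = h v + c i) (hy : Inv K y) : Inv K (opX K h y) := by
  intro i v
  have h1 : EqP.opX K h y (flip K i v) = EqP.opX K (h + fun _ => c i) y v := by
    unfold EqP.opX
    simp only [Pi.add_apply, Pi.mul_apply]
    rw [opA_flip, opA_flip, hh]
    congr 2
    · congr 1; funext v; exact hy i v
    · funext v; simp [hh, hy i v]
  rw [h1, opX_add_left, opX_const, add_zero]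

def word (hs : List ((Fin m → P) → ZMod 2)) (y : (Fin m → P) → ZMod 2) :=
  hs.foldr (fun h y => opX K h y) y

def topV : (Fin m → P) → ZMod 2 := fun v => ∏ i, K.top (v i)

theorem prod_update (u : Fin m → P → ZMod 2) (v : Fin m → P) (i : Fin m) (w : P) :
    ∏ k, u k (update v i w k) = u i w * ∏ k ∈ Finset.univ.erase i, u k (v k) := by
  rw [← Finset.mul_prod_erase _ _ (Finset.mem_univ i), update_self]
  congr 1
  refine Finset.prod_congr rfl fun k hk => ?_
  rw [update_of_ne (Finset.ne_of_mem_erase hk)]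

theorem topV_inv : Inv K (topV K (m := m)) := by
  intro i v
  unfold topV flip
  rw [prod_update (fun _ => K.top), K.top_neg, Finset.mul_prod_erase _ (fun k => K.top (v k)) (Finset.mem_univ i)]

theorem opA_topV : opA K (topV K (m := m)) = 0 := by
  funext v
  unfold opA topV
  apply Finset.sum_eq_zero
  intro i _
  simp only [prod_update (fun _ => K.top), ← mul_assoc]
  rw [← Finset.sum_mul, K.e_top, zero_mul]

theorem opA_word (hs : List ((Fin m → P) → ZMod 2)) : opA K (word K hs (topV K)) = 0 := by
  induction hs with
  | nil => exact opA_topV K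
  | cons h hs ih =>
    change opA K (opX K h (word K hs (topV K))) = 0
    rw [opA_opX, ih]
    unfold opX
    rw [mul_zero, opA_zero]; simp

/-- `h` transforms by the character of `S`. -/
def Eqv (h : (Fin m → P) → ZMod 2) (S : Finset (Fin m)) : Prop :=
  ∀ i v, h (flip K i v) = h v + if i ∈ S then 1 else 0

def base (S : Finset (Fin m)) : (Fin m → P) → ZMod 2 := ∑ i ∈ S, fun v => K.L (v i)

theorem base_eqv (S : Finset (Fin m)) : Eqv K (base K S) S := by
  intro i v
  unfold base flip
  simp only [Finset.sum_apply]
  split_ifs with hi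
  · rw [← Finset.add_sum_erase _ _ hi, ← Finset.add_sum_erase _ (fun i => K.L (v i)) hi,
      update_self, K.L_neg]
    rw [Finset.sum_congr rfl (g := fun i => K.L (v i))]
    · ring
    · intro k hk
      rw [update_of_ne (Finset.ne_of_mem_erase hk)]
  · rw [add_zero]
    refine Finset.sum_congr rfl fun k hk => ?_
    rw [update_of_ne]
    rintro rfl; exact hi hk

theorem word_inv (l : List (((Fin m → P) → ZMod 2) × Finset (Fin m)))
    (hl : ∀ x ∈ l, Eqv K x.1 x.2) : Inv K (word K (l.map Prod.fst) (topV K)) := by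
  induction l with
  | nil => exact topV_inv K
  | cons x l ih =>
    exact Inv.opX K _ (hl x (by simp)) (ih fun y hy => hl y (by simp [hy]))

theorem word_base (l : List (((Fin m → P) → ZMod 2) × Finset (Fin m)))
    (hl : ∀ x ∈ l, Eqv K x.1 x.2) : ∃ z, Inv K z ∧
    word K (l.map Prod.fst) (topV K) =
      word K (l.map fun x => base K x.2) (topV K) + opA K z := by
  induction l with
  | nil => exact ⟨0, fun _ _ => rfl, by rw [opA_zero]; simp⟩
  | cons x l ih =>
    obtain ⟨z, hz, hz2⟩ := ih fun y hy => hl y (by simp [hy])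
    have hx := hl x (by simp)
    set W := word K (l.map fun x => base K x.2) (topV K) with hW
    have hWA : opA K W = 0 := opA_word K _
    have hWi : Inv K W := by
      have := word_inv K (l.map fun x => (base K x.2, x.2)) (by
        intro y hy
        simp only [List.mem_map] at hy
        obtain ⟨a, _, rfl⟩ := hy
        exact base_eqv K _)
      simpa [Function.comp_def] using this
    set c := x.1 + base K x.2 with hc
    have hci : Inv K c := by
      intro i v
      simp only [hc, Pi.add_apply]
      rw [hx i v, base_eqv K x.2 i v]
      linear_combination two_add (if i ∈ x.2 then 1 else 0)
    have hx1 : x.1 = base K x.2 + c := by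
      rw [hc, add_comm x.1, ← add_assoc, fun_two_add, zero_add]
    refine ⟨c * W + opX K x.1 z, ?_, ?_⟩
    · have := Inv.opX K _ hx hz
      intro i v
      simp only [Pi.add_apply, Pi.mul_apply, hci i v, hWi i v, this i v]
    · change opX K x.1 (word K (l.map Prod.fst) (topV K)) = opX K (base K x.2) W + _
      rw [hz2, opX_add_right, opA_add, opA_opX]
      rw [← add_assoc]
      congr 1
      rw [hx1, opX_add_left]
      congr 1
      unfold opX
      rw [hWA, mul_zero, zero_add]

def Lam (y : (Fin m → P) → ZMod 2) : ZMod 2 := ∑ v, (∏ i, K.lam (v i)) * y v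

theorem Lam_opA (z : (Fin m → P) → ZMod 2) (hz : Inv K z) : Lam K (opA K z) = 0 := by
  unfold Lam opA
  simp only [Finset.mul_sum]
  rw [Finset.sum_comm]
  apply Finset.sum_eq_zero
  intro j _
  have h1 : ∑ v : Fin m → P, ∑ w, (∏ i, K.lam (v i)) * (K.e (v j) w * z (update v j w))
      = ∑ v : Fin m → P, (∏ i ∈ Finset.univ.erase j, K.lam (v i)) *
        (∑ q, K.lam q * K.e q (v j)) * z v := by
    simp only [Finset.mul_sum, Finset.sum_mul]
    rw [← Fintype.sum_prod_type', ← Fintype.sum_prod_type']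
    let φ : (Fin m → P) × P → (Fin m → P) × P := fun x => (update x.1 j x.2, x.1 j)
    have hφ : ∀ x, φ (φ x) = x := by rintro ⟨v, w⟩; simp [φ]
    refine Fintype.sum_equiv ⟨φ, φ, hφ, hφ⟩ _ _ ?_
    rintro ⟨v, w⟩
    simp only [φ, Equiv.coe_fn_mk, update_self]
    rw [← Finset.mul_prod_erase _ _ (Finset.mem_univ j)]
    rw [Finset.prod_congr (s₂ := Finset.univ.erase j) rfl (g := fun i => K.lam (update v j w i))]
    · ring
    · intro k hk
      rw [update_of_ne (Finset.ne_of_mem_erase hk)]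
  rw [h1]
  have hflip : ∀ v : Fin m → P, flip K j v ≠ v := by
    intro v hv
    have : K.L (flip K j v j) = K.L (v j) := by rw [hv]
    simp [flip, K.L_neg] at this
  refine Finset.sum_involution (fun v _ => flip K j v) ?_ (fun v _ _ => hflip v) (by simp)
    (fun v _ => flip_flip K j v)
  intro v _
  rw [hz j v]
  have : (flip K j v) j = K.neg (v j) := by simp [flip]
  rw [this, K.lam_e]
  rw [Finset.prod_congr (s₂ := Finset.univ.erase j) rfl (f := fun i => K.lam (flip K j v i))
    (g := fun i => K.lam (v i))]
  · exact two_add _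
  · intro k hk
    rw [flip, update_of_ne (Finset.ne_of_mem_erase hk)]

def Y (u : P → ZMod 2) : P → ZMod 2 := fun p => ∑ w, K.e p w * (K.L p + K.L w) * u w

def T (a : Fin m →₀ ℕ) : (Fin m → P) → ZMod 2 := fun v => ∏ i, ((Y K)^[a i] K.top) (v i)

theorem T_succ (a : Fin m →₀ ℕ) (i : Fin m) :
    opX K (fun v => K.L (v i)) (T K a) = T K (a + Finsupp.single i 1) := by
  funext v
  have h1 : T K (a + Finsupp.single i 1) v =
      ∑ w, K.e (v i) w * (K.L (v i) + K.L w) * T K a (update v i w) := by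
    unfold T
    simp only [prod_update (fun k => (Y K)^[a k] K.top)]
    rw [← Finset.mul_prod_erase _ _ (Finset.mem_univ i)]
    simp only [Finsupp.coe_add, Pi.add_apply, Finsupp.single_eq_same, iterate_succ_apply']
    simp only [← mul_assoc]
    rw [← Finset.sum_mul]
    congr 1
    refine Finset.prod_congr rfl fun k hk => ?_
    rw [Finsupp.single_eq_of_ne (Finset.ne_of_mem_erase hk), add_zero]
  rw [h1]
  unfold opX opA
  simp only [Pi.add_apply, Pi.mul_apply, Finset.mul_sum]
  rw [← Finset.sum_add_distrib]
  rw [Finset.sum_eq_single i]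
  · rw [← Finset.sum_add_distrib]
    refine Finset.sum_congr rfl fun w _ => ?_
    rw [update_self]; ring
  · intro j _ hj
    rw [← Finset.sum_add_distrib]
    apply Finset.sum_eq_zero
    intro w _
    rw [update_of_ne (Ne.symm hj)]
    linear_combination two_add (K.L (v i) * (K.e (v j) w * T K a (update v j w)))
  · simp

noncomputable def Psi : MvPolynomial (Fin m) (ZMod 2) →ₗ[ZMod 2] ((Fin m → P) → ZMod 2) :=
  (MvPolynomial.basisMonomials (Fin m) (ZMod 2)).constr (ZMod 2) (T K)

theorem Psi_monomial (a : Fin m →₀ ℕ) : Psi K (MvPolynomial.monomial a 1) = T K a := by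
  have := (MvPolynomial.basisMonomials (Fin m) (ZMod 2)).constr_basis (ZMod 2) (T K) a
  simpa [Psi] using this

theorem opX_smul_right (h y : (Fin m → P) → ZMod 2) (c : ZMod 2) :
    opX K h (c • y) = c • opX K h y := by
  unfold opX
  have h1 : c • y = fun v => c * y v := rfl
  have h2 : h * (fun v => c * y v) = fun v => c * (h * y) v := by
    funext v; simp only [Pi.mul_apply]; ring
  rw [h1, h2, opA_smul, opA_smul]
  funext v
  simp only [Pi.add_apply, Pi.mul_apply, Pi.smul_apply, smul_eq_mul]
  ring

theorem Psi_X (i : Fin m) (p : MvPolynomial (Fin m) (ZMod 2)) :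
    Psi K (MvPolynomial.X i * p) = opX K (fun v => K.L (v i)) (Psi K p) := by
  induction p using MvPolynomial.induction_on' with
  | monomial a b =>
    have : (MvPolynomial.monomial a b : MvPolynomial (Fin m) (ZMod 2)) =
        b • MvPolynomial.monomial a 1 := by
      rw [MvPolynomial.smul_monomial]; simp
    rw [this, mul_smul_comm, map_smul, map_smul, Psi_monomial, opX_smul_right, T_succ,
      MvPolynomial.X, MvPolynomial.monomial_mul, mul_one, Psi_monomial, add_comm]
  | add p q hp hq => rw [mul_add, map_add, map_add, opX_add_right, hp, hq]

theorem word_base_eq (l : List (Finset (Fin m))) :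
    word K (l.map (base K)) (topV K) =
      Psi K (l.map fun S => ∑ i ∈ S, (MvPolynomial.X i : MvPolynomial (Fin m) (ZMod 2))).prod := by
  induction l with
  | nil =>
    have : (1 : MvPolynomial (Fin m) (ZMod 2)) = MvPolynomial.monomial 0 1 := rfl
    simp only [List.map_nil, List.prod_nil]
    rw [this, Psi_monomial]
    rfl
  | cons S l ih =>
    rw [List.map_cons, List.map_cons, List.prod_cons]
    change opX K (base K S) (word K (l.map (base K)) (topV K)) = _
    rw [ih, Finset.sum_mul, map_sum, base, opX_sum_left]
    refine Finset.sum_congr rfl fun i _ => ?_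
    rw [Psi_X]

theorem Lam_add (y z : (Fin m → P) → ZMod 2) : Lam K (y + z) = Lam K y + Lam K z := by
  simp only [Lam, Pi.add_apply, mul_add, Finset.sum_add_distrib]

theorem Lam_T (a : Fin m →₀ ℕ) : Lam K (T K a) = if ∀ i, a i = K.D then 1 else 0 := by
  unfold Lam T
  simp only [← Finset.prod_mul_distrib]
  have := Finset.prod_univ_sum (fun _ : Fin m => (Finset.univ : Finset P))
    (fun i p => K.lam p * ((Y K)^[a i] K.top) p)
  rw [Fintype.piFinset_univ] at this
  rw [← this]
  have hv : ∀ i, ∑ p, K.lam p * ((Y K)^[a i] K.top) p = if a i = K.D then 1 else 0 :=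
    fun i => K.val (a i)
  simp only [hv]
  rw [Finset.prod_ite_zero]
  simp

theorem Lam_Psi (p : MvPolynomial (Fin m) (ZMod 2)) (b : Fin m →₀ ℕ) (hb : ∀ i, b i = K.D) :
    Lam K (Psi K p) = p.coeff b := by
  have h1 : p = ∑ a ∈ p.support, p.coeff a • MvPolynomial.monomial a 1 := by
    conv_lhs => rw [p.as_sum]
    refine Finset.sum_congr rfl fun a _ => ?_
    rw [MvPolynomial.smul_monomial]; simp
  let Lm : ((Fin m → P) → ZMod 2) →ₗ[ZMod 2] ZMod 2 :=
    { toFun := Lam K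
      map_add' := Lam_add K
      map_smul' := by
        intro c y
        simp only [Lam, Pi.smul_apply, smul_eq_mul, Finset.mul_sum, RingHom.id_apply]
        refine Finset.sum_congr rfl fun _ _ => ?_
        ring }
  change Lm (Psi K p) = _
  conv_lhs => rw [h1]
  simp only [map_sum, map_smul, Psi_monomial]
  have : ∀ a, Lm (T K a) = if a = b then 1 else 0 := by
    intro a
    change Lam K (T K a) = _
    rw [Lam_T]
    have : (∀ i, a i = K.D) ↔ a = b := by
      constructor
      · intro h; ext i; rw [h, hb]
      · rintro rfl; exact hb
    simp only [this]
  simp only [this, smul_eq_mul, mul_ite, mul_one, mul_zero]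
  rw [Finset.sum_ite_eq']
  split_ifs with h
  · rfl
  · exact (MvPolynomial.notMem_support_iff.mp h).symm

theorem comb_main (l : List (((Fin m → P) → ZMod 2) × Finset (Fin m)))
    (hl : ∀ x ∈ l, Eqv K x.1 x.2) (b : Fin m →₀ ℕ) (hb : ∀ i, b i = K.D) :
    Lam K (word K (l.map Prod.fst) (topV K)) =
      (l.map fun x => ∑ i ∈ x.2, (MvPolynomial.X i : MvPolynomial (Fin m) (ZMod 2))).prod.coeff b := by
  obtain ⟨z, hz, h⟩ := word_base K l hl
  rw [h, Lam_add, Lam_opA K z hz, add_zero]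
  have := word_base_eq K (l.map Prod.snd)
  rw [List.map_map, List.map_map] at this
  rw [← Lam_Psi K _ b hb]
  congr 1

/-- vanishing of words when one labelling is locally constant -/
theorem word_vanish (dst : (Fin m → P) → (Fin m → P) → ℝ) (δ : ℝ)
    (hself : ∀ v, dst v v = 0)
    (htri : ∀ u v w, dst u w ≤ dst u v + dst v w)
    (hE : ∀ v i w, K.e (v i) w ≠ 0 → dst v (update v i w) ≤ δ)
    (hs : List ((Fin m → P) → ZMod 2)) (y : (Fin m → P) → ZMod 2) (v : Fin m → P) (c : ZMod 2)
    (hδ : 0 ≤ δ)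
    (h : (Fin m → P) → ZMod 2) (hh : h ∈ hs) (hc : ∀ w, dst v w ≤ hs.length * δ → h w = c) :
    word K hs y v = 0 := by
  induction hs generalizing v with
  | nil => simp at hh
  | cons g hs ih =>
    change opX K g (word K hs y) v = 0
    have h1 : opX K g (word K hs y) v = ∑ i, ∑ w, K.e (v i) w *
        (g v + g (update v i w)) * word K hs y (update v i w) := by
      unfold opX opA
      simp only [Pi.add_apply, Pi.mul_apply, Finset.mul_sum, ← Finset.sum_add_distrib]
      refine Finset.sum_congr rfl fun i _ => Finset.sum_congr rfl fun w _ => ?_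
      ring
    rw [h1]
    refine Finset.sum_eq_zero fun i _ => Finset.sum_eq_zero fun w _ => ?_
    by_cases he : K.e (v i) w = 0
    · rw [he]; ring
    have hd := hE v i w he
    have hlen : ((g :: hs).length : ℝ) * δ = hs.length * δ + δ := by
      push_cast [List.length_cons]; ring
    rw [hlen] at hc
    have hn : 0 ≤ (hs.length : ℝ) * δ := by positivity
    rcases List.mem_cons.mp hh with rfl | hh
    · rw [hc v (by rw [hself]; linarith), hc (update v i w) (by linarith), two_add]; ring
    · rw [ih (update v i w) hh (fun w' hw' => hc w' (by linarith [htri v (update v i w) w'])), mul_zero]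

end abs

section conc
variable {d n : ℕ}

/-- boundary of the Khalimsky cube -/
abbrev PP (d n : ℕ) : Type := {x : Fin d → ℤ // (∀ c, |x c| ≤ 2 * n) ∧ ∃ c, |x c| = 2 * n}

noncomputable instance : Fintype (PP d n) := by
  have : Finite (PP d n) := by
    have hf : (Set.Icc (fun _ => -(2 * n : ℤ)) (fun _ => (2 * n : ℤ)) : Set (Fin d → ℤ)).Finite :=
      Set.finite_Icc _ _
    refine Set.Finite.to_subtype (s := {x : Fin d → ℤ | (∀ c, |x c| ≤ 2 * n) ∧ ∃ c, |x c| = 2 * n})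
      (hf.subset ?_)
    rintro x ⟨hx, _⟩
    exact ⟨fun c => (abs_le.mp (hx c)).1, fun c => (abs_le.mp (hx c)).2⟩
  exact Fintype.ofFinite _

def E (a b : Fin d → ℤ) : Prop :=
  ∃ c, Even (a c) ∧ |b c - a c| = 1 ∧ ∀ c', c' ≠ c → b c' = a c'

def ev (x : Fin d → ℤ) : ℕ := (Finset.univ.filter fun c => Even (x c)).card

open Classical in
noncomputable def LL (x : Fin d → ℤ) : ZMod 2 := if ∃ p, x p < 0 ∧ ∀ q < p, x q = 0 then 1 else 0

theorem LL_lead (x : Fin d → ℤ) (j : Fin d) (h0 : ∀ q < j, x q = 0) (hj : x j ≠ 0) :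
    LL x = if x j < 0 then 1 else 0 := by
  unfold LL
  congr 1
  apply propext
  constructor
  · rintro ⟨p, hp, hq⟩
    rcases lt_trichotomy p j with h | h | h
    · have := h0 p h; omega
    · subst h; exact hp
    · exact absurd (hq j h) hj
  · intro h; exact ⟨j, h, h0⟩

theorem exists_lead (x : Fin d → ℤ) (hx : ∃ c, x c ≠ 0) : ∃ j, (∀ q < j, x q = 0) ∧ x j ≠ 0 := by
  classical
  obtain ⟨c, hc⟩ := hx
  have hne : (Finset.univ.filter fun c => x c ≠ 0).Nonempty := ⟨c, by simp [hc]⟩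
  refine ⟨(Finset.univ.filter fun c => x c ≠ 0).min' hne, ?_, ?_⟩
  · intro q hq
    by_contra h
    exact absurd (Finset.min'_le _ q (by simp [h])) (not_le.mpr hq)
  · have := Finset.min'_mem _ hne
    simpa using this

theorem LL_neg (x : Fin d → ℤ) (hx : ∃ c, x c ≠ 0) : LL (fun c => - x c) = LL x + 1 := by
  obtain ⟨j, h0, hj⟩ := exists_lead x hx
  rw [LL_lead x j h0 hj, LL_lead (fun c => - x c) j (fun q hq => by simp [h0 q hq]) (by simpa using hj)]
  rcases lt_or_gt_of_ne hj with h | h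
  · rw [if_neg (by omega), if_pos h]; decide
  · rw [if_pos (by omega), if_neg (by omega)]; decide

theorem PP_ne (hn : 1 ≤ n) (x : PP d n) : ∃ c, x.1 c ≠ 0 := by
  obtain ⟨c, hc⟩ := x.2.2
  refine ⟨c, fun h => ?_⟩
  rw [h] at hc; simp at hc; omega

theorem E_odd {a b : Fin d → ℤ} {c : Fin d} (h1 : Even (a c)) (h2 : |b c - a c| = 1) : Odd (b c) := by
  rcases (abs_eq (by norm_num)).mp h2 with h | h
  · have : b c = a c + 1 := by omega
    rw [this]; exact h1.add_one
  · have : b c = a c - 1 := by omega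
    rw [this]; exact h1.sub_odd odd_one

theorem E_ev {a b : Fin d → ℤ} (h : E a b) : ev a = ev b + 1 := by
  obtain ⟨c, h1, h2, h3⟩ := h
  have hb := E_odd h1 h2
  unfold ev
  have : (Finset.univ.filter fun c => Even (a c)) = insert c (Finset.univ.filter fun c => Even (b c)) := by
    ext x
    simp only [Finset.mem_filter, Finset.mem_univ, true_and, Finset.mem_insert]
    by_cases hx : x = c
    · subst hx; simp [h1]
    · rw [h3 x hx]; simp [hx]
  rw [this, Finset.card_insert_of_notMem]
  simpa using hb

theorem E_neg {a b : Fin d → ℤ} (h : E a b) : E (fun c => - a c) (fun c => - b c) := by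
  obtain ⟨c, h1, h2, h3⟩ := h
  refine ⟨c, by simpa using h1, ?_, fun c' hc' => by simp [h3 c' hc']⟩
  rw [← h2, ← abs_neg]; congr 1; ring

def negP (x : PP d n) : PP d n := ⟨fun c => - x.1 c, by simpa using x.2⟩

theorem down {a b : Fin d → ℤ} (h : E a b) (hb : (∀ c, |b c| ≤ 2 * n) ∧ ∃ c, |b c| = 2 * n) :
    (∀ c, |a c| ≤ 2 * n) ∧ ∃ c, |a c| = 2 * n := by
  obtain ⟨c, h1, h2, h3⟩ := h
  have ho := E_odd h1 h2
  constructor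
  · intro x
    by_cases hx : x = c
    · subst hx
      have := hb.1 x
      rw [abs_le] at this ⊢
      rcases (abs_eq (by norm_num)).mp h2 with h | h <;> rcases ho with ⟨k, hk⟩ <;> constructor <;> omega
    · rw [← h3 x hx]; exact hb.1 x
  · obtain ⟨x, hx⟩ := hb.2
    refine ⟨x, ?_⟩
    rw [← h3 x ?_]; exact hx
    rintro rfl
    rcases ho with ⟨k, hk⟩
    rcases abs_eq (by positivity) |>.mp hx with h | h <;> omega

open Classical in
noncomputable def eP (a b : PP d n) : ZMod 2 := if E a.1 b.1 then 1 else 0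

noncomputable def topP (a : PP d n) : ZMod 2 := if ev a.1 = 1 then 1 else 0

noncomputable def lamP (a : PP d n) : ZMod 2 := if ev a.1 = d then 1 + LL a.1 else 0

theorem ev_neg (x : Fin d → ℤ) : ev (fun c => - x c) = ev x := by
  unfold ev; simp

theorem eP_neg (a b : PP d n) : eP (negP a) (negP b) = eP a b := by
  unfold eP
  congr 1
  apply propext
  constructor
  · intro h
    have := E_neg h
    simpa [negP] using this
  · exact E_neg

theorem eP_sq (a c : PP d n) : ∑ b, eP a b * eP b c = 0 := by
  classical
  have h1 : ∀ b : PP d n, eP a b * eP b c = if E a.1 b.1 ∧ E b.1 c.1 then 1 else 0 := by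
    intro b; unfold eP
    by_cases h : E a.1 b.1 <;> by_cases h' : E b.1 c.1 <;> simp [h, h']
  simp only [h1]
  rw [← Finset.sum_filter]
  have key : ∀ b : PP d n, E a.1 b.1 → E b.1 c.1 →
      E a.1 (fun x => a.1 x + c.1 x - b.1 x) ∧ E (fun x => a.1 x + c.1 x - b.1 x) c.1 ∧
      (fun x => a.1 x + c.1 x - b.1 x) ≠ b.1 := by
    rintro b ⟨p, hp1, hp2, hp3⟩ ⟨q, hq1, hq2, hq3⟩
    have hpo := E_odd hp1 hp2
    have hpq : p ≠ q := by
      rintro rfl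
      exact (Int.not_even_iff_odd.mpr hpo) hq1
    refine ⟨⟨q, ?_, ?_, ?_⟩, ⟨p, ?_, ?_, ?_⟩, ?_⟩
    · rw [← hp3 q hpq.symm]; exact hq1
    · rw [← hq2]; congr 1; ring
    · intro x hx; simp only; rw [hq3 x hx]; ring
    · simp only; rw [hq3 p hpq]; simpa using hp1
    · rw [← hp2]; congr 1; ring
    · intro x hx; simp only; rw [hp3 x hx]; ring
    · intro h
      have := congrFun h p
      rw [hq3 p hpq] at this
      have h3 : b.1 p - a.1 p = 0 := by linarith
      rw [h3] at hp2; simp at hp2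
  have hmf : ∀ b : PP d n, b ∈ Finset.univ.filter (fun b : PP d n => E a.1 b.1 ∧ E b.1 c.1) →
      E a.1 b.1 ∧ E b.1 c.1 := fun b hb => (Finset.mem_filter.mp hb).2
  refine Finset.sum_involution (fun b hb => ⟨fun x => a.1 x + c.1 x - b.1 x,
    down (key b (hmf b hb).1 (hmf b hb).2).2.1 c.2⟩) ?_ ?_ ?_ ?_
  · intro b _; decide
  · intro b hb _ h
    simp only [Finset.mem_filter, Finset.mem_univ, true_and] at hb
    exact (key b hb.1 hb.2).2.2 (congrArg Subtype.val h)
  · intro b hb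
    simp only [Finset.mem_filter, Finset.mem_univ, true_and] at hb ⊢
    exact ⟨(key b hb.1 hb.2).1, (key b hb.1 hb.2).2.1⟩
  · intro b hb
    apply Subtype.ext
    funext x
    simp

/-- sum over an explicit pair -/
theorem sum_pair_zero {α : Type} [Fintype α] (f : α → ZMod 2) (x y : α) (hxy : x ≠ y)
    (h : ∀ z, z ≠ x → z ≠ y → f z = 0) : ∑ z, f z = f x + f y := by
  classical
  rw [← Finset.sum_pair hxy]
  symm
  apply Finset.sum_subset (Finset.subset_univ _)
  intro z _ hz
  simp only [Finset.mem_insert, Finset.mem_singleton, not_or] at hz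
  exact h z hz.1 hz.2

theorem E_bot (p : PP d n) : ∑ q : PP d n, (if ev q.1 = d then 1 else 0) * eP q p = 0 := by
  classical
  have h1 : ∀ b : PP d n, (if ev b.1 = d then 1 else 0) * eP b p =
      if ev b.1 = d ∧ E b.1 p.1 then (1 : ZMod 2) else 0 := by
    intro b; unfold eP
    by_cases h : ev b.1 = d <;> by_cases h' : E b.1 p.1 <;> simp [h, h']
  simp only [h1]
  by_cases hex : ∃ b : PP d n, ev b.1 = d ∧ E b.1 p.1
  swap
  · apply Finset.sum_eq_zero
    intro b _
    rw [if_neg]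
    intro h; exact hex ⟨b, h⟩
  have hall : ∀ x : Fin d → ℤ, ev x = d → ∀ c, Even (x c) := by
    intro x hx c
    unfold ev at hx
    have : (Finset.univ.filter fun c => Even (x c)) = Finset.univ := by
      apply Finset.eq_univ_of_card; simpa using hx
    have h := Finset.mem_univ c
    rw [← this] at h
    simpa using h
  have hall' : ∀ x : Fin d → ℤ, (∀ c, Even (x c)) → ev x = d := by
    intro x hx
    unfold ev
    rw [Finset.filter_true_of_mem (fun c _ => hx c)]; simp
  obtain ⟨b, hb, c, hc1, hc2, hc3⟩ := hex
  have hb' := hall _ hb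
  have hpo := E_odd hc1 hc2
  have hE' : E (Function.update b.1 c (2 * p.1 c - b.1 c)) p.1 := by
    refine ⟨c, ?_, ?_, ?_⟩
    · rw [Function.update_self]; exact (even_two_mul _).sub hc1
    · rw [Function.update_self, ← hc2, ← abs_neg]; congr 1; ring
    · intro x hx; rw [Function.update_of_ne hx]; exact hc3 x hx
  have hev' : ev (Function.update b.1 c (2 * p.1 c - b.1 c)) = d := by
    apply hall'
    intro x
    by_cases hx : x = c
    · subst hx; rw [Function.update_self]; exact (even_two_mul _).sub hc1
    · rw [Function.update_of_ne hx]; exact hb' x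
  rw [sum_pair_zero _ b ⟨_, down hE' p.2⟩]
  · rw [if_pos ⟨hb, c, hc1, hc2, hc3⟩, if_pos ⟨hev', hE'⟩]; decide
  · intro h
    have := congrFun (congrArg Subtype.val h) c
    simp only [Function.update_self] at this
    have : p.1 c - b.1 c = 0 := by linarith
    rw [this] at hc2; simp at hc2
  · rintro z hz1 hz2
    rw [if_neg]
    rintro ⟨hz, c', hc1', hc2', hc3'⟩
    have hcc : c' = c := by
      by_contra hne
      have := hc3 c' hne
      have h2 := E_odd hc1' hc2'
      rw [this] at h2
      exact (Int.not_even_iff_odd.mpr h2) (hb' c')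
    subst hcc
    have hoff : ∀ x, x ≠ c' → z.1 x = b.1 x := fun x hx => by rw [← hc3' x hx, hc3 x hx]
    have hon : z.1 c' = b.1 c' ∨ z.1 c' = 2 * p.1 c' - b.1 c' := by
      rcases (abs_eq (by norm_num)).mp hc2 with h | h <;>
      rcases (abs_eq (by norm_num)).mp hc2' with h' | h' <;> omega
    rcases hon with h | h
    · apply hz1
      apply Subtype.ext; funext x
      by_cases hx : x = c'
      · subst hx; exact h
      · exact hoff x hx
    · apply hz2
      apply Subtype.ext; funext x
      by_cases hx : x = c'
      · subst hx; simpa using h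
      · simp only; rw [Function.update_of_ne hx]; exact hoff x hx

theorem eP_top (hn : 1 ≤ n) (a : PP d n) : ∑ b, eP a b * topP b = 0 := by
  classical
  have h1 : ∀ b : PP d n, eP a b * topP b = if E a.1 b.1 ∧ ev b.1 = 1 then 1 else 0 := by
    intro b; unfold eP topP
    by_cases h : E a.1 b.1 <;> by_cases h' : ev b.1 = 1 <;> simp [h, h']
  simp only [h1]
  by_cases ha : ev a.1 = 2
  swap
  · apply Finset.sum_eq_zero
    intro b _
    rw [if_neg]
    rintro ⟨h, h'⟩
    have := E_ev h
    omega
  obtain ⟨p, hp⟩ := a.2.2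
  have hpe : Even (a.1 p) := by
    rcases abs_eq (by positivity) |>.mp hp with h | h <;> rw [h]
    · exact even_two_mul _
    · simp
  obtain ⟨q, hqp, hset⟩ : ∃ q, q ≠ p ∧ ∀ x, Even (a.1 x) ↔ x = p ∨ x = q := by
    unfold ev at ha
    obtain ⟨x, y, hxy, h⟩ := Finset.card_eq_two.mp ha
    have h' : ∀ z, Even (a.1 z) ↔ z = x ∨ z = y := by
      intro z
      have := Finset.ext_iff.mp h z
      simpa using this
    rcases (h' p).mp hpe with rfl | rfl
    · exact ⟨y, hxy.symm, h'⟩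
    · exact ⟨x, hxy, fun z => by rw [h' z, or_comm]⟩
  have hqe : Even (a.1 q) := (hset q).mpr (Or.inr rfl)
  have hE1 : ∀ (c : Fin d) (s : ℤ), |s| = 1 → Even (a.1 c) →
      E a.1 (Function.update a.1 c (a.1 c + s)) := by
    intro c s hs hc
    refine ⟨c, hc, by simpa using hs, fun x hx => by rw [Function.update_of_ne hx]⟩
  have hEc : ∀ b : Fin d → ℤ, E a.1 b → ∃ c s, (c = p ∨ c = q) ∧ (s = 1 ∨ s = -1) ∧
      b = Function.update a.1 c (a.1 c + s) := by
    rintro b ⟨c, h1, h2, h3⟩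
    refine ⟨c, b c - a.1 c, (hset c).mp h1, (abs_eq (by norm_num)).mp h2, ?_⟩
    funext x
    by_cases hx : x = c
    · subst hx; simp
    · rw [Function.update_of_ne hx, h3 x hx]
  have hEev : ∀ b : Fin d → ℤ, E a.1 b → ev b = 1 := by
    intro b hb
    have := E_ev hb
    omega
  have hmem : ∀ (c c' : Fin d) (s : ℤ), c ≠ c' → |a.1 c'| = 2 * n → |a.1 c + s| ≤ 2 * n →
      ((∀ x, |Function.update a.1 c (a.1 c + s) x| ≤ 2 * n) ∧
        ∃ x, |Function.update a.1 c (a.1 c + s) x| = 2 * n) := by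
    intro c c' s hcc h1 h2
    refine ⟨fun x => ?_, c', by rw [Function.update_of_ne hcc.symm]; exact h1⟩
    by_cases hx : x = c
    · subst hx; simpa using h2
    · rw [Function.update_of_ne hx]; exact a.2.1 x
  by_cases hq : |a.1 q| = 2 * n
  · -- both extremal
    have hs : ∀ c, |a.1 c| = 2 * n → ∃ s : ℤ, |s| = 1 ∧ |a.1 c + s| ≤ 2 * n ∧
        ∀ s', (s' = 1 ∨ s' = -1) → |a.1 c + s'| ≤ 2 * n → s' = s := by
      intro c hc
      rcases abs_eq (by positivity) |>.mp hc with h | h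
      · refine ⟨-1, by simp, by rw [h, abs_le]; constructor <;> omega, ?_⟩
        rintro s' (rfl | rfl) h'
        · rw [h, abs_le] at h'; omega
        · rfl
      · refine ⟨1, by simp, by rw [h, abs_le]; constructor <;> omega, ?_⟩
        rintro s' (rfl | rfl) h'
        · rfl
        · rw [h, abs_le] at h'; omega
    obtain ⟨s1, hs1, hs1', hu1⟩ := hs p hp
    obtain ⟨s2, hs2, hs2', hu2⟩ := hs q hq
    rw [sum_pair_zero _ ⟨_, hmem p q s1 hqp.symm hq hs1'⟩ ⟨_, hmem q p s2 hqp hp hs2'⟩]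
    · rw [if_pos ⟨hE1 p s1 hs1 hpe, hEev _ (hE1 p s1 hs1 hpe)⟩,
        if_pos ⟨hE1 q s2 hs2 hqe, hEev _ (hE1 q s2 hs2 hqe)⟩]; decide
    · intro h
      have := congrFun (congrArg Subtype.val h) p
      simp only [Function.update_self] at this
      rw [Function.update_of_ne hqp.symm] at this
      have : s1 = 0 := by omega
      rw [this] at hs1; simp at hs1
    · intro z hz1 hz2
      rw [if_neg]
      rintro ⟨hz, _⟩
      obtain ⟨c, s, hc, hs, hb⟩ := hEc _ hz
      have hle := z.2.1 c
      rw [hb, Function.update_self] at hle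
      rcases hc with rfl | rfl
      · exact hz1 (Subtype.ext (by rw [hb, hu1 s hs hle]))
      · exact hz2 (Subtype.ext (by rw [hb, hu2 s hs hle]))
  · have hlt : |a.1 q| < 2 * n := lt_of_le_of_ne (a.2.1 q) hq
    have hle : ∀ s : ℤ, |s| = 1 → |a.1 q + s| ≤ 2 * n := by
      intro s hs
      have := abs_add_le (a.1 q) s
      omega
    have h1 : |(1 : ℤ)| = 1 := by simp
    have h2 : |(-1 : ℤ)| = 1 := by simp
    rw [sum_pair_zero _ ⟨_, hmem q p 1 hqp hp (hle 1 h1)⟩ ⟨_, hmem q p (-1) hqp hp (hle (-1) h2)⟩]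
    · rw [if_pos ⟨hE1 q 1 h1 hqe, hEev _ (hE1 q _ h1 hqe)⟩,
        if_pos ⟨hE1 q _ h2 hqe, hEev _ (hE1 q _ h2 hqe)⟩]; decide
    · intro h
      have := congrFun (congrArg Subtype.val h) q
      simp only [Function.update_self] at this
      omega
    · intro z hz1 hz2
      rw [if_neg]
      rintro ⟨hz, _⟩
      obtain ⟨c, s, hc, hs, hb⟩ := hEc _ hz
      rcases hc with rfl | rfl
      · -- changing p destroys extremality
        obtain ⟨x, hx⟩ := z.2.2
        have hxe : Even (z.1 x) := by
          rcases abs_eq (by positivity) |>.mp hx with h | h <;> rw [h]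
          · exact even_two_mul _
          · simp
        rw [hb] at hx hxe
        by_cases hxc : x = c
        · subst hxc
          rw [Function.update_self] at hxe
          rcases hpe with ⟨k, hk⟩
          rcases hxe with ⟨k', hk'⟩
          omega
        · rw [Function.update_of_ne hxc] at hx hxe
          rcases (hset x).mp hxe with h | h
          · exact hxc h
          · subst h; exact hq hx
      · rcases hs with rfl | rfl
        · exact hz1 (Subtype.ext hb)
        · exact hz2 (Subtype.ext hb)

theorem lamP_e (hn : 1 ≤ n) (p : PP d n) : ∑ q, lamP q * eP q (negP p) = ∑ q, lamP q * eP q p := by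
  have hnn : ∀ x : PP d n, negP (negP x) = x := fun x => Subtype.ext (by simp [negP])
  have h1 : ∑ q, lamP q * eP q (negP p) = ∑ q, lamP (negP q) * eP q p := by
    refine Fintype.sum_equiv ⟨negP, negP, hnn, hnn⟩ _ _ fun q => ?_
    simp only [Equiv.coe_fn_mk, hnn]
    rw [← eP_neg q, hnn]
  have h2 : ∀ q : PP d n, lamP (negP q) = lamP q + if ev q.1 = d then 1 else 0 := by
    intro q
    unfold lamP
    have : ev (negP q).1 = ev q.1 := ev_neg q.1
    rw [this]
    have hL : LL (negP q).1 = LL q.1 + 1 := LL_neg q.1 (PP_ne hn q)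
    rw [hL]
    split_ifs
    · ring
    · ring
  rw [h1]
  simp only [h2, add_mul, Finset.sum_add_distrib]
  rw [E_bot, add_zero]

noncomputable def YP (u : PP d n → ZMod 2) : PP d n → ZMod 2 :=
  fun p => ∑ w, eP p w * (LL p.1 + LL w.1) * u w

theorem YP_supp (k : ℕ) (p : PP d n) (h : (YP^[k] topP) p ≠ 0) : ev p.1 = k + 1 := by
  induction k generalizing p with
  | zero =>
    by_contra hne
    apply h
    simp only [Function.iterate_zero, id_eq, topP]
    rw [if_neg]; simpa using hne
  | succ k ih =>
    rw [Function.iterate_succ_apply'] at h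
    obtain ⟨w, _, hw⟩ := Finset.exists_ne_zero_of_sum_ne_zero h
    have h1 := ih w (right_ne_zero_of_mul hw)
    have h2 : eP p w ≠ 0 := left_ne_zero_of_mul (left_ne_zero_of_mul hw)
    have h3 : E p.1 w.1 := by
      by_contra hne; apply h2; unfold eP; rw [if_neg hne]
    have := E_ev h3
    omega

open Classical in
theorem YP_eq (hn : 1 ≤ n) (k : ℕ) (hk : k < d) (v : PP d n) :
    (YP^[k] topP) v = if (∀ i : Fin d, i.1 < k → v.1 i = 0) ∧ ev v.1 = k + 1 then 1 else 0 := by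
  induction k generalizing v with
  | zero => simp [topP]
  | succ k ih =>
    rw [Function.iterate_succ_apply']
    set j : Fin d := ⟨k, by omega⟩ with hj
    -- key facts about w
    have hlead : ∀ w : PP d n, (∀ i : Fin d, i.1 < k → w.1 i = 0) → ev w.1 = k + 1 → w.1 j ≠ 0 := by
      intro w hw hev h0
      obtain ⟨x, hx⟩ := w.2.2
      have hxne : w.1 x ≠ 0 := by
        intro h; rw [h] at hx; simp at hx; omega
      have hxe : Even (w.1 x) := by
        rcases abs_eq (by positivity) |>.mp hx with h | h <;> rw [h]
        · exact even_two_mul _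
        · simp
      have hsub : insert x (Finset.univ.filter fun i : Fin d => i.1 < k + 1) ⊆
          Finset.univ.filter fun c => Even (w.1 c) := by
        intro z hz
        simp only [Finset.mem_insert, Finset.mem_filter, Finset.mem_univ, true_and] at hz ⊢
        rcases hz with rfl | hz
        · exact hxe
        · rcases Nat.lt_succ_iff_lt_or_eq.mp hz with h | h
          · rw [hw z h]; simp
          · have : z = j := Fin.ext h
            rw [this, h0]; simp
      have hcard := Finset.card_le_card hsub
      rw [Finset.card_insert_of_notMem] at hcard
      · have : (Finset.univ.filter fun i : Fin d => i.1 < k + 1).card = k + 1 := by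
          rw [Fin.card_filter_val_lt]; omega
        rw [this] at hcard
        unfold ev at hev
        omega
      · simp only [Finset.mem_filter, Finset.mem_univ, true_and, not_lt]
        by_contra hlt
        rw [not_le] at hlt
        rcases Nat.lt_succ_iff_lt_or_eq.mp hlt with h | h
        · exact hxne (hw x h)
        · have : x = j := Fin.ext h
          rw [this] at hxne; exact hxne h0
    have hterm : ∀ w : PP d n, eP v w * (LL v.1 + LL w.1) * (YP^[k] topP) w ≠ 0 →
        ((∀ i : Fin d, i.1 < k + 1 → v.1 i = 0) ∧ ev v.1 = k + 2) ∧
        (w.1 = Function.update v.1 j 1 ∨ w.1 = Function.update v.1 j (-1)) := by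
      intro w hw
      rw [ih (by omega)] at hw
      have h3 := right_ne_zero_of_mul hw
      have h2 := right_ne_zero_of_mul (left_ne_zero_of_mul hw)
      have h1 := left_ne_zero_of_mul (left_ne_zero_of_mul hw)
      have hE : E v.1 w.1 := by
        by_contra hne; apply h1; unfold eP; rw [if_neg hne]
      have hc : (∀ i : Fin d, i.1 < k → w.1 i = 0) ∧ ev w.1 = k + 1 := by
        by_contra hne; apply h3; rw [if_neg hne]
      have hwj := hlead w hc.1 hc.2
      have hev := E_ev hE
      obtain ⟨c, hc1, hc2, hc3⟩ := hE
      have hco := E_odd hc1 hc2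
      have hcne : w.1 c ≠ 0 := by
        intro h; rw [h] at hco; simp at hco
      have hck : k ≤ c.1 := by
        by_contra hlt
        exact hcne (hc.1 c (by omega))
      have hv0 : ∀ i : Fin d, i.1 < k → v.1 i = 0 := by
        intro i hi
        rw [← hc3 i (by rintro rfl; omega)]; exact hc.1 i hi
      have hLw := LL_lead w.1 j (fun q hq => hc.1 q hq) hwj
      by_cases hvj : v.1 j = 0
      · have hcj : c = j := by
          by_contra hne
          rw [hc3 j (Ne.symm hne)] at hwj
          exact hwj hvj
        subst hcj
        refine ⟨⟨?_, by omega⟩, ?_⟩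
        · intro i hi
          rcases Nat.lt_succ_iff_lt_or_eq.mp hi with h | h
          · exact hv0 i h
          · have : i = ⟨k, by omega⟩ := Fin.ext h
            rw [this]; exact hvj
        · rw [hvj, sub_zero] at hc2
          have heq : ∀ s, w.1 j = s → w.1 = Function.update v.1 j s := by
            intro s hs
            funext x
            by_cases hx : x = j
            · subst hx; simpa using hs
            · rw [Function.update_of_ne hx]; exact hc3 x hx
          rcases (abs_eq (by norm_num)).mp hc2 with h | h
          · exact Or.inl (heq _ h)
          · exact Or.inr (heq _ h)
      · exfalso
        have hLv := LL_lead v.1 j (fun q hq => hv0 q hq) hvj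
        apply h2
        rw [hLv, hLw]
        have : (v.1 j < 0) ↔ (w.1 j < 0) := by
          by_cases hcj : c = j
          · subst hcj
            rcases hc1 with ⟨r, hr⟩
            rcases (abs_eq (by norm_num)).mp hc2 with h | h <;> omega
          · rw [hc3 j (Ne.symm hcj)]
        simp only [this]
        exact two_add _
    by_cases hv : (∀ i : Fin d, i.1 < k + 1 → v.1 i = 0) ∧ ev v.1 = k + 1 + 1
    · rw [if_pos hv]
      have hvj : v.1 j = 0 := hv.1 j (by simp [hj])
      have hP : ∀ s : ℤ, |s| = 1 → ((∀ x, |Function.update v.1 j s x| ≤ 2 * n) ∧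
          ∃ x, |Function.update v.1 j s x| = 2 * n) := by
        intro s hs
        constructor
        · intro x
          by_cases hx : x = j
          · subst hx; rw [Function.update_self, hs]; omega
          · rw [Function.update_of_ne hx]; exact v.2.1 x
        · obtain ⟨x, hx⟩ := v.2.2
          refine ⟨x, ?_⟩
          rw [Function.update_of_ne]; exact hx
          rintro rfl
          rw [hvj] at hx; simp at hx; omega
      have hEs : ∀ s : ℤ, |s| = 1 → E v.1 (Function.update v.1 j s) := by
        intro s hs
        refine ⟨j, by rw [hvj]; simp, by rw [hvj]; simpa using hs,
          fun x hx => by rw [Function.update_of_ne hx]⟩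
      have hval : ∀ (s : ℤ) (hs : |s| = 1), (YP^[k] topP) (⟨_, hP s hs⟩ : PP d n) = 1 := by
        intro s hs
        rw [ih (by omega), if_pos]
        refine ⟨fun i hi => ?_, ?_⟩
        · simp only
          rw [Function.update_of_ne]
          · exact hv.1 i (by omega)
          · rintro rfl; simp [hj] at hi
        · have := E_ev (hEs s hs)
          simp only
          omega
      have h1 : |(1 : ℤ)| = 1 := by simp
      have h2 : |(-1 : ℤ)| = 1 := by simp
      have hLs : ∀ (s : ℤ), |s| = 1 → LL (Function.update v.1 j s) = if s < 0 then 1 else 0 := by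
        intro s hs
        have := LL_lead (Function.update v.1 j s) j (fun q hq => by
          rw [Function.update_of_ne hq.ne]; exact hv.1 q (by
            have : q.1 < k := hq
            omega)) (by
          rw [Function.update_self]; rintro rfl; simp at hs)
        rw [this, Function.update_self]
      unfold YP
      rw [sum_pair_zero _ ⟨_, hP 1 h1⟩ ⟨_, hP (-1) h2⟩]
      · have hv1 := hval 1 h1
        have hv2 := hval (-1) h2
        unfold YP at hv1 hv2
        rw [hv1, hv2]
        unfold eP
        simp only
        rw [if_pos (hEs 1 h1), if_pos (hEs (-1) h2), hLs 1 h1, hLs (-1) h2]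
        norm_num
        linear_combination two_add (LL v.1)
      · intro h
        have := congrFun (congrArg Subtype.val h) j
        simp at this
      · intro z hz1 hz2
        by_contra hne
        rcases (hterm z hne).2 with h | h
        · exact hz1 (Subtype.ext h)
        · exact hz2 (Subtype.ext h)
    · rw [if_neg hv]
      apply Finset.sum_eq_zero
      intro w _
      by_contra hne
      exact hv (hterm w hne).1

theorem valP (hn : 1 ≤ n) (hd : 1 ≤ d) (k : ℕ) :
    ∑ p : PP d n, lamP p * (YP^[k] topP) p = if k = d - 1 then 1 else 0 := by
  classical
  split_ifs with hk
  · subst hk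
    set j : Fin d := ⟨d - 1, by omega⟩ with hj
    have hmem : ∀ c, |(Pi.single j (2 * n : ℤ) : Fin d → ℤ) c| ≤ 2 * n := by
      intro c
      by_cases hc : c = j
      · subst hc; simp
      · rw [Pi.single_eq_of_ne hc]; simp
    let p0 : PP d n := ⟨Pi.single j (2 * n : ℤ), hmem, j, by simp⟩
    rw [Finset.sum_eq_single p0]
    · have hev : ev p0.1 = d := by
        unfold ev
        rw [Finset.filter_true_of_mem]
        · simp
        · intro c _
          by_cases hc : c = j
          · subst hc; simp [p0]
          · simp only [p0]; rw [Pi.single_eq_of_ne hc]; simp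
      have hz : ∀ i : Fin d, i.1 < d - 1 → p0.1 i = 0 := by
        intro i hi
        simp only [p0]
        rw [Pi.single_eq_of_ne]
        rintro rfl; simp [hj] at hi
      rw [YP_eq hn _ (by omega), if_pos ⟨hz, by omega⟩]
      unfold lamP
      rw [if_pos hev, LL_lead p0.1 j (fun q hq => hz q hq) (by simp [p0]; omega), if_neg]
      · simp
      · simp [p0]
    · intro p _ hp
      by_contra hne
      have h1 := left_ne_zero_of_mul hne
      have h2 := right_ne_zero_of_mul hne
      rw [YP_eq hn _ (by omega)] at h2
      have hc : (∀ i : Fin d, i.1 < d - 1 → p.1 i = 0) ∧ ev p.1 = d - 1 + 1 := by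
        by_contra hne; apply h2; rw [if_neg hne]
      have hoff : ∀ i, i ≠ j → p.1 i = 0 := by
        intro i hi
        apply hc.1
        have : i.1 ≠ d - 1 := fun h => hi (Fin.ext h)
        have := i.2
        omega
      have habs : |p.1 j| = 2 * n := by
        obtain ⟨x, hx⟩ := p.2.2
        by_cases hxj : x = j
        · rw [← hxj]; exact hx
        · rw [hoff x hxj] at hx; simp at hx; omega
      have hjne : p.1 j ≠ 0 := by
        intro h; rw [h] at habs; simp at habs; omega
      unfold lamP at h1
      rw [if_pos (by omega), LL_lead p.1 j (fun q hq => hoff q hq.ne) hjne] at h1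
      split_ifs at h1 with hneg
      · exact h1 (by decide)
      · apply hp
        apply Subtype.ext
        funext x
        by_cases hx : x = j
        · subst hx
          rw [abs_of_nonneg (by omega)] at habs
          simp [p0, habs]
        · rw [hoff x hx]; simp only [p0]; rw [Pi.single_eq_of_ne hx]
    · simp
  · apply Finset.sum_eq_zero
    intro p _
    by_contra hne
    have h1 := left_ne_zero_of_mul hne
    have h2 := YP_supp k p (right_ne_zero_of_mul hne)
    unfold lamP at h1
    split_ifs at h1 with h
    · omega
    · exact h1 rfl

noncomputable def KP (d n : ℕ) (hd : 1 ≤ d) (hn : 1 ≤ n) : Cx (PP d n) where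
  e := eP
  neg := negP
  L := fun p => LL p.1
  lam := lamP
  top := topP
  D := d - 1
  neg_neg := fun x => Subtype.ext (by simp [negP])
  e_neg := eP_neg
  top_neg := fun p => by
    unfold topP
    have : ev (negP p).1 = ev p.1 := ev_neg p.1
    rw [this]
  L_neg := fun p => LL_neg p.1 (PP_ne hn p)
  e_sq := eP_sq
  e_top := eP_top hn
  lam_e := lamP_e hn
  val := valP hn hd

end conc

section BU

open Function

/-- realization of grid points -/
noncomputable def rl {d n : ℕ} (x : PP d n) : EuclideanSpace ℝ (Fin d) :=
  WithLp.toLp 2 (fun c => (x.1 c : ℝ))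

noncomputable def pr {d n : ℕ} (x : PP d n) : EuclideanSpace ℝ (Fin d) := (‖rl x‖)⁻¹ • rl x

theorem rl_norm {d n : ℕ} (x : PP d n) : (2 * n : ℝ) ≤ ‖rl x‖ := by
  obtain ⟨c, hc⟩ := x.2.2
  have h := PiLp.norm_apply_le (rl x) c
  have : ‖(rl x) c‖ = 2 * n := by
    simp only [rl, Real.norm_eq_abs]
    exact_mod_cast hc
  linarith

theorem pr_norm {d n : ℕ} (hn : 1 ≤ n) (x : PP d n) : ‖pr x‖ = 1 := by
  have h := rl_norm x
  have hn' : (1 : ℝ) ≤ n := by exact_mod_cast hn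
  unfold pr
  rw [norm_smul, norm_inv, norm_norm, inv_mul_cancel₀]
  linarith

theorem pr_neg {d n : ℕ} (x : PP d n) : pr (negP x) = - pr x := by
  have : rl (negP x) = - rl x := by
    ext c; simp [rl, negP]
  unfold pr
  rw [this, norm_neg, smul_neg]

theorem pr_dist {d n : ℕ} (hn : 1 ≤ n) (x y : PP d n) (h : E x.1 y.1) :
    dist (pr x) (pr y) ≤ 1 / n := by
  have hx := rl_norm x
  have hy := rl_norm y
  have hn' : (1 : ℝ) ≤ n := by exact_mod_cast hn
  have hxy : ‖rl x - rl y‖ = 1 := by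
    obtain ⟨c, h1, h2, h3⟩ := h
    have hs : rl x - rl y = EuclideanSpace.single c ((x.1 c : ℝ) - y.1 c) := by
      ext k
      by_cases hk : k = c
      · subst hk; simp [rl]
      · simp [rl, h3 k hk, hk]
    rw [hs, EuclideanSpace.norm_single, Real.norm_eq_abs, abs_sub_comm]
    exact_mod_cast h2
  have e1 : pr x - pr y = (‖rl x‖)⁻¹ • (rl x - rl y) + ((‖rl x‖)⁻¹ - (‖rl y‖)⁻¹) • rl y := by
    unfold pr
    rw [smul_sub, sub_smul]; abel
  have hx0 : 0 < ‖rl x‖ := by linarith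
  have hy0 : 0 < ‖rl y‖ := by linarith
  have hd : |‖rl y‖ - ‖rl x‖| ≤ 1 := by
    rw [← hxy, ← norm_neg (rl x - rl y), neg_sub]; exact abs_norm_sub_norm_le _ _
  have e2 : |(‖rl x‖)⁻¹ - (‖rl y‖)⁻¹| * ‖rl y‖ ≤ (‖rl x‖)⁻¹ := by
    have : (‖rl x‖)⁻¹ - (‖rl y‖)⁻¹ = (‖rl y‖ - ‖rl x‖) * (‖rl x‖)⁻¹ * (‖rl y‖)⁻¹ := by
      field_simp
    rw [this, abs_mul, abs_mul, abs_of_pos (inv_pos.mpr hx0), abs_of_pos (inv_pos.mpr hy0),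
      mul_assoc, mul_assoc, inv_mul_cancel₀ hy0.ne', mul_one]
    have := inv_pos.mpr hx0
    nlinarith
  have e3 : (‖rl x‖)⁻¹ ≤ (2 * n : ℝ)⁻¹ := inv_anti₀ (by linarith) hx
  rw [dist_eq_norm, e1]
  calc _ ≤ ‖(‖rl x‖)⁻¹ • (rl x - rl y)‖ + ‖((‖rl x‖)⁻¹ - (‖rl y‖)⁻¹) • rl y‖ := norm_add_le _ _
    _ ≤ (‖rl x‖)⁻¹ + (‖rl x‖)⁻¹ := by
        rw [norm_smul, norm_smul, hxy, Real.norm_eq_abs, Real.norm_eq_abs,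
          abs_of_pos (inv_pos.mpr hx0), mul_one]
        linarith
    _ ≤ (2 * n : ℝ)⁻¹ + (2 * n : ℝ)⁻¹ := by linarith
    _ = 1 / n := by field_simp; norm_num

theorem BU0 {ι : Type} [Fintype ι] (m d : ℕ) (hd : 1 ≤ d) (S : ι → Finset (Fin m))
    (F : (Fin m → EuclideanSpace ℝ (Fin d)) → ι → ℝ)
    (hF : ContinuousOn F {u | ∀ i, ‖u i‖ = 1})
    (heq : ∀ u, (∀ i, ‖u i‖ = 1) → ∀ i r,
      F (update u i (- u i)) r = if i ∈ S r then - F u r else F u r)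
    (b : Fin m →₀ ℕ) (hb : ∀ i, b i = d - 1)
    (hc : (∏ r, ∑ i ∈ S r, (MvPolynomial.X i : MvPolynomial (Fin m) (ZMod 2))).coeff b ≠ 0) :
    ∃ u, (∀ i, ‖u i‖ = 1) ∧ ∀ r, F u r = 0 := by
  classical
  by_contra hno
  push Not at hno
  set Kset : Set (Fin m → EuclideanSpace ℝ (Fin d)) := {u | ∀ i, ‖u i‖ = 1} with hK
  have hcomp : IsCompact Kset := by
    have : Kset = Set.pi Set.univ (fun _ => Metric.sphere (0 : EuclideanSpace ℝ (Fin d)) 1) := by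
      ext u; simp [hK]
    rw [this]
    exact isCompact_univ_pi fun _ => isCompact_sphere _ _
  obtain ⟨ε, hε, hmin⟩ : ∃ ε > 0, ∀ u ∈ Kset, ε ≤ ‖F u‖ := by
    rcases Set.eq_empty_or_nonempty Kset with h | h
    · exact ⟨1, one_pos, by simp [h]⟩
    · obtain ⟨u0, hu0, hm⟩ := hcomp.exists_isMinOn h hF.norm
      refine ⟨‖F u0‖, ?_, fun u hu => hm hu⟩
      obtain ⟨r, hr⟩ := hno u0 hu0
      rw [gt_iff_lt, norm_pos_iff]
      intro h0; exact hr (by rw [h0]; rfl)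
  have huc := hcomp.uniformContinuousOn_of_continuous hF
  rw [Metric.uniformContinuousOn_iff] at huc
  obtain ⟨δ, hδ, huc⟩ := huc ε hε
  obtain ⟨n0, hn0⟩ := exists_nat_gt ((Fintype.card ι : ℝ) / δ)
  set n := n0 + 1 with hn
  have hn1 : 1 ≤ n := by omega
  have hnpos : (0 : ℝ) < n := by positivity
  have hNn : (Fintype.card ι : ℝ) * (1 / n) < δ := by
    have : (Fintype.card ι : ℝ) / δ < n := by rw [hn]; push_cast; linarith
    rw [div_lt_iff₀ hδ] at this
    rw [mul_one_div, div_lt_iff₀ hnpos]; linarith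
  let K := KP d n hd hn1
  let pm : (Fin m → PP d n) → (Fin m → EuclideanSpace ℝ (Fin d)) := fun v i => pr (v i)
  have hpm : ∀ v, pm v ∈ Kset := fun v i => pr_norm hn1 (v i)
  have hpf : ∀ i v, pm (flip K i v) = update (pm v) i (- pm v i) := by
    intro i v
    funext k
    by_cases hk : k = i
    · subst hk; simp only [pm, flip, update_self]; exact pr_neg _
    · simp only [pm, flip]; rw [update_of_ne hk, update_of_ne hk]
  let h : ι → (Fin m → PP d n) → ZMod 2 := fun r v =>
    if 0 < F (pm v) r then 0 else if F (pm v) r < 0 then 1 else base K (S r) v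
  have hh : ∀ r, Eqv K (h r) (S r) := by
    intro r i v
    have h1 := heq (pm v) (hpm v) i r
    simp only [h, hpf, h1, base_eqv K (S r) i v]
    by_cases hi : i ∈ S r
    · simp only [hi, if_true]
      rcases lt_trichotomy (F (pm v) r) 0 with hlt | hlt | hlt
      · rw [if_pos (by linarith), if_neg (by linarith), if_pos hlt]; decide
      · simp [hlt]
      · rw [if_neg (by linarith), if_pos (by linarith), if_pos hlt]; decide
    · simp only [hi, if_false, add_zero]
  have hmain := comb_main K (Finset.univ.toList.map fun r => (h r, S r)) (by
    intro x hx
    simp only [List.mem_map] at hx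
    obtain ⟨r, _, rfl⟩ := hx
    exact hh r) b hb
  rw [List.map_map, List.map_map] at hmain
  have hprod : (List.map ((fun x : ((Fin m → PP d n) → ZMod 2) × Finset (Fin m) =>
      ∑ i ∈ x.2, (MvPolynomial.X i : MvPolynomial (Fin m) (ZMod 2))) ∘
      fun r => (h r, S r)) Finset.univ.toList).prod
      = ∏ r, ∑ i ∈ S r, (MvPolynomial.X i : MvPolynomial (Fin m) (ZMod 2)) := by
    rw [← Finset.prod_map_toList]; rfl
  rw [hprod] at hmain
  apply hc
  rw [← hmain]
  apply Finset.sum_eq_zero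
  intro v _
  obtain ⟨r, hr⟩ : ∃ r, ε ≤ |F (pm v) r| := by
    by_contra hcon
    push Not at hcon
    have := (pi_norm_lt_iff (x := F (pm v)) hε).mpr (fun r => hcon r)
    exact absurd (hmin _ (hpm v)) (not_le.mpr this)
  rw [word_vanish K (fun v w => dist (pm v) (pm w)) (1 / n) (fun v => dist_self _)
    (fun u v w => dist_triangle _ _ _) ?_ _ _ v (h r v) (by positivity) (h r) ?_ ?_, mul_zero]
  · intro v i w he
    have hE : E (v i).1 w.1 := by
      by_contra hne
      apply he
      change eP (v i) w = 0
      unfold eP; rw [if_neg hne]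
    rw [dist_pi_le_iff (by positivity)]
    intro k
    by_cases hk : k = i
    · subst hk; simp only [pm, update_self]; exact pr_dist hn1 _ _ hE
    · simp only [pm]; rw [update_of_ne hk, dist_self]; positivity
  · simp only [List.mem_map, Finset.mem_toList, Finset.mem_univ, true_and]
    exact ⟨r, rfl⟩
  · intro w hw
    rw [List.length_map, Finset.length_toList, Finset.card_univ] at hw
    have hdist := huc (pm v) (hpm v) (pm w) (hpm w) (lt_of_le_of_lt hw hNn)
    have h2 := lt_of_le_of_lt (dist_le_pi_dist (F (pm v)) (F (pm w)) r) hdist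
    rw [Real.dist_eq, abs_lt] at h2
    simp only [h]
    rcases le_abs'.mp hr with h3 | h3
    · rw [if_neg (by linarith), if_pos (by linarith), if_neg (by linarith), if_pos (by linarith)]
    · rw [if_pos (by linarith), if_pos (by linarith)]

theorem BU {ι : Type} [Fintype ι] (m d : ℕ) (hd : 1 ≤ d) (S : ι → Finset (Fin m))
    (F : (Fin m → EuclideanSpace ℝ (Fin d)) → ι → ℝ)
    (hF : ContinuousOn F {u | ∀ i, ‖u i‖ = 1})
    (heq : ∀ u, (∀ i, ‖u i‖ = 1) → ∀ i r,
      F (update u i (- u i)) r = if i ∈ S r then - F u r else F u r)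
    (hc : (∏ r, ∑ i ∈ S r, (MvPolynomial.X i : MvPolynomial (Fin m) (ZMod 2))) ∉
      Ideal.span (Set.range fun i : Fin m =>
        (MvPolynomial.X i : MvPolynomial (Fin m) (ZMod 2)) ^ d)) :
    ∃ u, (∀ i, ‖u i‖ = 1) ∧ ∀ r, F u r = 0 := by
  classical
  set p := ∏ r, ∑ i ∈ S r, (MvPolynomial.X i : MvPolynomial (Fin m) (ZMod 2)) with hp
  obtain ⟨a, ha, had⟩ : ∃ a ∈ p.support, ∀ i, a i < d := by
    by_contra hcon
    push Not at hcon
    apply hc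
    have hset : (Set.range fun i : Fin m => (MvPolynomial.X i : MvPolynomial (Fin m) (ZMod 2)) ^ d) =
        (fun s => MvPolynomial.monomial s (1 : ZMod 2)) '' (Set.range fun i => Finsupp.single i d) := by
      ext q
      simp [MvPolynomial.X_pow_eq_monomial]
    rw [hset, MvPolynomial.mem_ideal_span_monomial_image]
    intro x hx
    obtain ⟨i, hi⟩ := hcon x hx
    exact ⟨_, ⟨i, rfl⟩, Finsupp.single_le_iff.mpr hi⟩
  let S' : (ι ⊕ (Σ i : Fin m, Fin (d - 1 - a i))) → Finset (Fin m) :=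
    Sum.elim S (fun x => {x.1})
  let F' : (Fin m → EuclideanSpace ℝ (Fin d)) → (ι ⊕ (Σ i : Fin m, Fin (d - 1 - a i))) → ℝ :=
    fun u => Sum.elim (F u) (fun x => u x.1 ⟨0, hd⟩)
  let b : Fin m →₀ ℕ := Finsupp.equivFunOnFinite.symm (fun i => d - 1 - a i)
  suffices hkey : ∃ u, (∀ i, ‖u i‖ = 1) ∧ ∀ r, F' u r = 0 by
    obtain ⟨u, hu, h0⟩ := hkey
    exact ⟨u, hu, fun r => h0 (Sum.inl r)⟩
  refine BU0 m d hd S' F' ?_ ?_ (a + b) ?_ ?_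
  · rw [continuousOn_pi]
    rintro (r | x)
    · exact continuousOn_pi.mp hF r
    · apply Continuous.continuousOn
      change Continuous fun u : Fin m → EuclideanSpace ℝ (Fin d) => u x.1 ⟨0, hd⟩
      fun_prop
  · rintro u hu i (r | x)
    · exact heq u hu i r
    · simp only [F', S', Sum.elim_inr, Finset.mem_singleton]
      by_cases hi : i = x.1
      · subst hi; simp
      · rw [update_of_ne (Ne.symm hi), if_neg hi]
  · intro i
    have := had i
    simp only [b, Finsupp.coe_add, Pi.add_apply, Finsupp.equivFunOnFinite_symm_apply_apply]
    omega
  · rw [Fintype.prod_sum_type]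
    simp only [S', Sum.elim_inl, Sum.elim_inr, Finset.sum_singleton]
    rw [Fintype.prod_sigma]
    simp only [Finset.prod_const, Finset.card_univ, Fintype.card_fin]
    have : ∏ i, (MvPolynomial.X i : MvPolynomial (Fin m) (ZMod 2)) ^ (d - 1 - a i) =
        MvPolynomial.monomial b 1 := by
      rw [MvPolynomial.monomial_eq, Finsupp.prod_fintype _ _ (by simp)]
      simp [b]
    rw [this, ← hp, MvPolynomial.coeff_mul_monomial, mul_one]
    exact MvPolynomial.mem_support_iff.mp ha

end BU

section meas

open MeasureTheory Function Filter Topology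

noncomputable def sgn (r : ℝ) : ℝ := if 0 < r then 1 else if r < 0 then -1 else 0

theorem sgn_pos {r : ℝ} (h : 0 < r) : sgn r = 1 := by simp [sgn, h]
theorem sgn_of_neg {r : ℝ} (h : r < 0) : sgn r = -1 := by
  unfold sgn; rw [if_neg (by linarith), if_pos h]
theorem sgn_neg (r : ℝ) : sgn (-r) = - sgn r := by
  rcases lt_trichotomy r 0 with h | h | h
  · rw [sgn_of_neg h, sgn_pos (by linarith)]; ring
  · subst h; simp [sgn]
  · rw [sgn_pos h, sgn_of_neg (by linarith)]
theorem abs_sgn (r : ℝ) : |sgn r| ≤ 1 := by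
  unfold sgn; split_ifs <;> simp

theorem sgn_meas : Measurable sgn := by
  unfold sgn
  exact Measurable.ite measurableSet_Ioi measurable_const
    (Measurable.ite measurableSet_Iio measurable_const measurable_const)

theorem sgn_cont {r : ℝ} (h : r ≠ 0) : ContinuousAt sgn r := by
  rcases lt_or_gt_of_ne h with h | h
  · have : sgn =ᶠ[𝓝 r] fun _ => -1 := by
      filter_upwards [Iio_mem_nhds h] with x hx using sgn_of_neg hx
    exact continuousAt_const.congr this.symm
  · have : sgn =ᶠ[𝓝 r] fun _ => 1 := by
      filter_upwards [Ioi_mem_nhds h] with x hx using sgn_pos hx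
    exact continuousAt_const.congr this.symm

noncomputable def Hv (r : ℝ) : ℝ := (1 + sgn r) / 2

theorem Hv_pos {r : ℝ} (h : 0 < r) : Hv r = 1 := by rw [Hv, sgn_pos h]; norm_num
theorem Hv_of_neg {r : ℝ} (h : r < 0) : Hv r = 0 := by rw [Hv, sgn_of_neg h]; norm_num
theorem Hv_neg (r : ℝ) : Hv (-r) = 1 - Hv r := by unfold Hv; rw [sgn_neg]; ring
theorem Hv_nonneg (r : ℝ) : 0 ≤ Hv r := by
  unfold Hv; have := abs_le.mp (abs_sgn r); linarith
theorem Hv_le (r : ℝ) : Hv r ≤ 1 := by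
  unfold Hv; have := abs_le.mp (abs_sgn r); linarith
theorem Hv_meas : Measurable Hv := by
  unfold Hv; exact (measurable_const.add sgn_meas).div_const 2
theorem Hv_cont {r : ℝ} (h : r ≠ 0) : ContinuousAt Hv r := by
  unfold Hv
  exact (continuousAt_const.add (sgn_cont h)).div_const 2

variable {d : ℕ} (μ : Measure (EuclideanSpace ℝ (Fin d))) [IsFiniteMeasure μ]

local notation "V" => EuclideanSpace ℝ (Fin d)

/-- hyperplanes are null -/
def Null : Prop := ∀ u : EuclideanSpace ℝ (Fin d), ‖u‖ = 1 → ∀ s : ℝ, μ {x | inner ℝ x u = s} = 0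

noncomputable def Phi (u : V) (s : ℝ) : ℝ := ∫ x, Hv (s - inner ℝ x u) ∂μ

theorem meas_in (u : V) : Measurable fun x : V => (inner ℝ x u : ℝ) :=
  (continuous_id.inner continuous_const).measurable

theorem int_bdd {g : V → ℝ} (hm : Measurable g) (hb : ∀ x, |g x| ≤ 1) : Integrable g μ :=
  Integrable.of_bound hm.aestronglyMeasurable 1 (ae_of_all _ hb)

theorem Hv_int_meas (u : V) (s : ℝ) : Measurable fun x : V => Hv (s - inner ℝ x u) :=
  Hv_meas.comp (measurable_const.sub (meas_in u))

theorem Hv_abs (r : ℝ) : |Hv r| ≤ 1 := by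
  rw [abs_le]; constructor <;> linarith [Hv_nonneg r, Hv_le r]

theorem Hv_int (u : V) (s : ℝ) : Integrable (fun x : V => Hv (s - inner ℝ x u)) μ :=
  int_bdd μ (Hv_int_meas u s) fun _ => Hv_abs _

theorem Phi_neg (u : V) (s : ℝ) : Phi μ (-u) (-s) = μ.real Set.univ - Phi μ u s := by
  unfold Phi
  have : ∀ x : V, Hv (-s - inner ℝ x (-u)) = 1 - Hv (s - inner ℝ x u) := by
    intro x; rw [← Hv_neg, inner_neg_right]; congr 1; ring
  simp only [this]
  rw [integral_sub (integrable_const _) (Hv_int μ u s)]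
  simp

theorem ae_ne (hN : Null μ) (u : V) (hu : ‖u‖ = 1) (s : ℝ) : ∀ᵐ x ∂μ, (inner ℝ x u : ℝ) ≠ s := by
  rw [ae_iff]; simpa using hN u hu s

theorem Phi_cont (hN : Null μ) (u : V) (hu : ‖u‖ = 1) (s : ℝ) :
    ContinuousAt (fun p : V × ℝ => Phi μ p.1 p.2) (u, s) := by
  unfold Phi
  refine continuousAt_of_dominated (bound := fun _ => 1) ?_ ?_ (integrable_const _) ?_
  · exact Eventually.of_forall fun p => (Hv_int_meas p.1 p.2).aestronglyMeasurable
  · exact Eventually.of_forall fun p => ae_of_all _ fun x => Hv_abs _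
  · filter_upwards [ae_ne μ hN u hu s] with x hx
    have h1 : ContinuousAt (fun p : V × ℝ => p.2 - inner ℝ x p.1) (u, s) := by
      apply Continuous.continuousAt
      exact continuous_snd.sub (continuous_const.inner continuous_fst)
    exact ContinuousAt.comp (f := fun p : V × ℝ => p.2 - inner ℝ x p.1) (g := Hv) (x := (u, s))
      (Hv_cont (by simpa [sub_eq_zero] using Ne.symm hx)) h1

theorem Phi_strict [μ.IsOpenPosMeasure] (u : V) (hu : ‖u‖ = 1) :
    StrictMono (Phi μ u) := by
  intro s s' hs
  unfold Phi
  have hle : ∀ x : V, Hv (s - inner ℝ x u) ≤ Hv (s' - inner ℝ x u) := by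
    intro x
    rcases lt_or_ge (s' - inner ℝ x u) 0 with h | h
    · rw [Hv_of_neg h, Hv_of_neg (by linarith)]
    · rcases h.lt_or_eq with h | h
      · rw [Hv_pos h]; exact Hv_le _
      · rw [Hv_of_neg (r := s - inner ℝ x u) (by linarith)]; exact Hv_nonneg _
  rw [← sub_pos, ← integral_sub (Hv_int μ u s') (Hv_int μ u s)]
  rw [integral_pos_iff_support_of_nonneg (fun x => sub_nonneg.mpr (hle x))
    ((Hv_int μ u s').sub (Hv_int μ u s))]
  have hop : IsOpen {x : V | s < inner ℝ x u ∧ inner ℝ x u < s'} := by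
    have hc : Continuous fun x : V => (inner ℝ x u : ℝ) := continuous_id.inner continuous_const
    exact (isOpen_lt continuous_const hc).inter (isOpen_lt hc continuous_const)
  have hne : {x : V | s < inner ℝ x u ∧ inner ℝ x u < s'}.Nonempty := by
    refine ⟨((s + s') / 2) • u, ?_⟩
    simp only [Set.mem_setOf_eq, inner_smul_left, real_inner_self_eq_norm_sq, hu]
    simp
    constructor <;> linarith
  refine lt_of_lt_of_le (hop.measure_pos μ hne) (measure_mono ?_)
  rintro x ⟨h1, h2⟩
  simp only [mem_support, Set.mem_setOf_eq]
  rw [Hv_pos (r := s' - inner ℝ x u) (by linarith), Hv_of_neg (by linarith)]; norm_num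

theorem Phi_top (u : V) : Tendsto (Phi μ u) atTop (𝓝 (μ.real Set.univ)) := by
  have h : μ.real Set.univ = ∫ _ : V, (1 : ℝ) ∂μ := by simp
  rw [h]
  unfold Phi
  refine tendsto_integral_filter_of_dominated_convergence (fun _ => 1) ?_ ?_ (integrable_const _) ?_
  · exact Eventually.of_forall fun s => (Hv_int_meas u s).aestronglyMeasurable
  · exact Eventually.of_forall fun p => ae_of_all _ fun x => Hv_abs _
  · refine ae_of_all _ fun x => ?_
    refine tendsto_const_nhds.congr' ?_
    filter_upwards [eventually_gt_atTop (inner ℝ x u : ℝ)] with s hs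
    rw [Hv_pos (by linarith)]

theorem Phi_bot (u : V) : Tendsto (Phi μ u) atBot (𝓝 0) := by
  have h : (0 : ℝ) = ∫ _ : V, (0 : ℝ) ∂μ := by simp
  rw [h]
  unfold Phi
  refine tendsto_integral_filter_of_dominated_convergence (fun _ => 1) ?_ ?_ (integrable_const _) ?_
  · exact Eventually.of_forall fun s => (Hv_int_meas u s).aestronglyMeasurable
  · exact Eventually.of_forall fun p => ae_of_all _ fun x => Hv_abs _
  · refine ae_of_all _ fun x => ?_
    refine tendsto_const_nhds.congr' ?_
    filter_upwards [eventually_lt_atBot (inner ℝ x u : ℝ)] with s hs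
    rw [Hv_of_neg (by linarith)]

open Classical in
/-- quantile level -/
noncomputable def qt (u : V) (c : ℝ) : ℝ :=
  if h : ∃ s, Phi μ u s = c * μ.real Set.univ then h.choose else 0

theorem qt_spec (hN : Null μ) (hM : 0 < μ.real Set.univ) (u : V) (hu : ‖u‖ = 1) (c : ℝ)
    (h0 : 0 < c) (h1 : c < 1) : Phi μ u (qt μ u c) = c * μ.real Set.univ := by
  have hex : ∃ s, Phi μ u s = c * μ.real Set.univ := by
    have hc : Continuous (Phi μ u) := by
      rw [continuous_iff_continuousAt]
      intro s
      exact ContinuousAt.comp (f := fun s => (u, s)) (g := fun p : V × ℝ => Phi μ p.1 p.2)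
        (Phi_cont μ hN u hu s) (by fun_prop)
    have hcM : 0 < c * μ.real Set.univ := mul_pos h0 hM
    have hcM' : c * μ.real Set.univ < μ.real Set.univ := by nlinarith
    obtain ⟨a, ha⟩ := ((Phi_bot μ u).eventually (gt_mem_nhds hcM)).exists
    obtain ⟨b, hb⟩ := ((Phi_top μ u).eventually (lt_mem_nhds hcM')).exists
    exact mem_range_of_exists_le_of_exists_ge hc ⟨a, ha.le⟩ ⟨b, hb.le⟩
  unfold qt
  rw [dif_pos hex]
  exact hex.choose_spec

variable [μ.IsOpenPosMeasure]

theorem qt_neg (hN : Null μ) (hM : 0 < μ.real Set.univ) (u : V) (hu : ‖u‖ = 1) (c : ℝ)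
    (h0 : 0 < c) (h1 : c < 1) : qt μ (-u) (1 - c) = - qt μ u c := by
  have hu' : ‖-u‖ = 1 := by rw [norm_neg]; exact hu
  apply (Phi_strict μ (-u) hu').injective
  rw [qt_spec μ hN hM (-u) hu' _ (by linarith) (by linarith), Phi_neg,
    qt_spec μ hN hM u hu c h0 h1]
  ring

theorem qt_lt (hN : Null μ) (hM : 0 < μ.real Set.univ) (u : V) (hu : ‖u‖ = 1) (c c' : ℝ)
    (h0 : 0 < c) (h1 : c' < 1) (h : c < c') : qt μ u c < qt μ u c' := by
  rw [← (Phi_strict μ u hu).lt_iff_lt, qt_spec μ hN hM u hu _ (by linarith) (by linarith),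
    qt_spec μ hN hM u hu _ (by linarith) (by linarith)]
  exact mul_lt_mul_of_pos_right h hM

theorem qt_cont (hN : Null μ) (hM : 0 < μ.real Set.univ) (c : ℝ)
    (h0 : 0 < c) (h1 : c < 1) : ContinuousOn (fun u => qt μ u c) {u : V | ‖u‖ = 1} := by
  intro u hu
  have hu : ‖u‖ = 1 := hu
  rw [ContinuousWithinAt, Metric.tendsto_nhds]
  intro ε hε
  have hs := qt_spec μ hN hM u hu c h0 h1
  have hc : ∀ s, ContinuousAt (fun u => Phi μ u s) u := by
    intro s
    exact ContinuousAt.comp (f := fun u => (u, s)) (g := fun p : V × ℝ => Phi μ p.1 p.2)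
        (Phi_cont μ hN u hu s) (by fun_prop)
  have hlo : Phi μ u (qt μ u c - ε) < c * μ.real Set.univ := by
    rw [← hs]; exact Phi_strict μ u hu (by linarith)
  have hhi : c * μ.real Set.univ < Phi μ u (qt μ u c + ε) := by
    rw [← hs]; exact Phi_strict μ u hu (by linarith)
  filter_upwards [self_mem_nhdsWithin,
    nhdsWithin_le_nhds ((hc (qt μ u c - ε)).eventually (gt_mem_nhds hlo)),
    nhdsWithin_le_nhds ((hc (qt μ u c + ε)).eventually (lt_mem_nhds hhi))] with w hw h2 h3
  have hw : ‖w‖ = 1 := hw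
  rw [← qt_spec μ hN hM w hw c h0 h1] at h2 h3
  rw [(Phi_strict μ w hw).lt_iff_lt] at h2 h3
  rw [Real.dist_eq, abs_lt]
  constructor <;> linarith

/-- cumulative functions -/
noncomputable def CC (k : ℕ) (u : V) (i : ℕ) (x : V) : ℝ :=
  if i = 0 then 0 else if i ≤ 2 * k + 1 then Hv (qt μ u ((i : ℝ) / (2 * k + 2)) - inner ℝ x u) else 1

noncomputable def chi (k : ℕ) (u : V) (i : ℕ) (x : V) : ℝ := (1 - CC μ k u i x) * CC μ k u (i + 1) x

noncomputable def sg (u : V) (x : V) : ℝ := sgn (inner ℝ x u - qt μ u (1 / 2))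

theorem frac (k i : ℕ) (h1 : 1 ≤ i) (h2 : i ≤ 2 * k + 1) :
    0 < (i : ℝ) / (2 * k + 2) ∧ (i : ℝ) / (2 * k + 2) < 1 := by
  have h1' : (1 : ℝ) ≤ i := by exact_mod_cast h1
  have h2' : (i : ℝ) ≤ 2 * k + 1 := by exact_mod_cast h2
  constructor
  · positivity
  · rw [div_lt_one (by positivity)]; linarith

theorem CC_meas (k : ℕ) (u : V) (i : ℕ) : Measurable (CC μ k u i) := by
  unfold CC
  split_ifs
  · exact measurable_const
  · exact Hv_int_meas u _
  · exact measurable_const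

theorem CC_bd (k : ℕ) (u : V) (i : ℕ) (x : V) : 0 ≤ CC μ k u i x ∧ CC μ k u i x ≤ 1 := by
  unfold CC
  split_ifs
  · simp
  · exact ⟨Hv_nonneg _, Hv_le _⟩
  · simp

end meas

section fin

open MeasureTheory Function Filter Topology

variable {d : ℕ} (μ : Measure (EuclideanSpace ℝ (Fin d))) [IsFiniteMeasure μ] [μ.IsOpenPosMeasure]

local notation "V" => EuclideanSpace ℝ (Fin d)

theorem CC_flip (hN : Null μ) (hM : 0 < μ.real Set.univ) (k : ℕ) (u : V) (hu : ‖u‖ = 1)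
    (i j : ℕ) (hij : i + j = 2 * k + 2) (x : V) : CC μ k (-u) i x = 1 - CC μ k u j x := by
  unfold CC
  by_cases hi : i = 0
  · have hj : j = 2 * k + 2 := by omega
    subst hj; subst hi; simp
  by_cases hj : j = 0
  · have hi : i = 2 * k + 2 := by omega
    subst hj; subst hi; simp
  rw [if_neg hi, if_neg hj, if_pos (by omega), if_pos (by omega)]
  obtain ⟨h1, h2⟩ := frac k j (by omega) (by omega)
  have e : (i : ℝ) / (2 * k + 2) = 1 - (j : ℝ) / (2 * k + 2) := by
    have : (i : ℝ) + j = 2 * k + 2 := by exact_mod_cast hij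
    have hp : (2 * (k : ℝ) + 2) ≠ 0 := by positivity
    field_simp
    linarith
  rw [e, qt_neg μ hN hM u hu _ h1 h2, ← Hv_neg, inner_neg_right]
  congr 1; ring

theorem chi_flip (hN : Null μ) (hM : 0 < μ.real Set.univ) (k : ℕ) (u : V) (hu : ‖u‖ = 1)
    (i j : ℕ) (hij : i + j = 2 * k + 1) (x : V) : chi μ k (-u) i x = chi μ k u j x := by
  unfold chi
  rw [CC_flip μ hN hM k u hu i (j + 1) (by omega), CC_flip μ hN hM k u hu (i + 1) j (by omega)]
  ring

theorem sg_flip (hN : Null μ) (hM : 0 < μ.real Set.univ) (u : V) (hu : ‖u‖ = 1) (x : V) :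
    sg μ (-u) x = - sg μ u x := by
  unfold sg
  have h := qt_neg μ hN hM u hu (1 / 2) (by norm_num) (by norm_num)
  have h2 : (1 : ℝ) - 1 / 2 = 1 / 2 := by norm_num
  rw [h2] at h
  rw [h, ← sgn_neg, inner_neg_right]
  congr 1; ring

theorem CC_mul (hN : Null μ) (hM : 0 < μ.real Set.univ) (k : ℕ) (u : V) (hu : ‖u‖ = 1)
    (i : ℕ) (x : V) : CC μ k u i x * CC μ k u (i + 1) x = CC μ k u i x := by
  unfold CC
  by_cases hi : i = 0
  · simp [hi]
  rw [if_neg hi, if_neg (Nat.succ_ne_zero i)]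
  by_cases h : i + 1 ≤ 2 * k + 1
  · rw [if_pos h, if_pos (by omega)]
    have hlt := qt_lt μ hN hM u hu ((i : ℝ) / (2 * k + 2)) (((i + 1 : ℕ) : ℝ) / (2 * k + 2))
      (frac k i (by omega) (by omega)).1 (frac k (i + 1) (by omega) h).2
      (by apply div_lt_div_of_pos_right _ (by positivity); push_cast; linarith)
    rcases lt_or_ge (qt μ u ((i : ℝ) / (2 * k + 2)) - inner ℝ x u) 0 with h | h
    · rw [Hv_of_neg h]; ring
    · rw [Hv_pos (r := qt μ u (((i + 1 : ℕ) : ℝ) / (2 * k + 2)) - inner ℝ x u) (by linarith)]; ring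
  · rw [if_neg h, mul_one]

theorem chi_eq (hN : Null μ) (hM : 0 < μ.real Set.univ) (k : ℕ) (u : V) (hu : ‖u‖ = 1)
    (i : ℕ) (x : V) : chi μ k u i x = CC μ k u (i + 1) x - CC μ k u i x := by
  unfold chi
  linear_combination -CC_mul μ hN hM k u hu i x

theorem CC_integ (hN : Null μ) (hM : 0 < μ.real Set.univ) (k : ℕ) (u : V) (hu : ‖u‖ = 1)
    (i : ℕ) (hi : i ≤ 2 * k + 2) :
    ∫ x, CC μ k u i x ∂μ = (i : ℝ) / (2 * k + 2) * μ.real Set.univ := by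
  unfold CC
  by_cases h0 : i = 0
  · simp [h0]
  by_cases h1 : i ≤ 2 * k + 1
  · simp only [if_neg h0, if_pos h1]
    exact qt_spec μ hN hM u hu _ (frac k i (by omega) h1).1 (frac k i (by omega) h1).2
  · have h2 : i = 2 * k + 2 := by omega
    simp only [if_neg h0, if_neg h1]
    subst h2
    have hp : (2 * (k : ℝ) + 2) ≠ 0 := by positivity
    push_cast
    rw [div_self hp]; simp

theorem CC_intg (k : ℕ) (u : V) (i : ℕ) : Integrable (CC μ k u i) μ :=
  int_bdd μ (CC_meas μ k u i) fun x => by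
    obtain ⟨h1, h2⟩ := CC_bd μ k u i x
    rw [abs_le]; constructor <;> linarith

theorem chi_integ (hN : Null μ) (hM : 0 < μ.real Set.univ) (k : ℕ) (u : V) (hu : ‖u‖ = 1)
    (i : ℕ) (hi : i ≤ 2 * k + 1) :
    ∫ x, chi μ k u i x ∂μ = μ.real Set.univ / (2 * k + 2) := by
  simp only [chi_eq μ hN hM k u hu]
  rw [integral_sub (CC_intg μ k u _) (CC_intg μ k u _), CC_integ μ hN hM k u hu _ (by omega),
    CC_integ μ hN hM k u hu _ (by omega)]
  push_cast
  ring

theorem sg_integ (hN : Null μ) (hM : 0 < μ.real Set.univ) (u : V) (hu : ‖u‖ = 1) :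
    ∫ x, sg μ u x ∂μ = 0 := by
  have h : ∀ x, sg μ u x = 1 - 2 * Hv (qt μ u (1 / 2) - inner ℝ x u) := by
    intro x
    unfold sg Hv
    rw [← neg_sub, sgn_neg]; ring
  simp only [h]
  rw [integral_sub (integrable_const _) ((Hv_int μ u _).const_mul 2), integral_const_mul]
  have := qt_spec μ hN hM u hu (1 / 2) (by norm_num) (by norm_num)
  unfold Phi at this
  rw [this]
  simp

theorem chi_meas (k : ℕ) (u : V) (i : ℕ) : Measurable (chi μ k u i) :=
  (measurable_const.sub (CC_meas μ k u i)).mul (CC_meas μ k u (i + 1))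

theorem chi_bd (k : ℕ) (u : V) (i : ℕ) (x : V) : |chi μ k u i x| ≤ 1 := by
  obtain ⟨h1, h2⟩ := CC_bd μ k u i x
  obtain ⟨h3, h4⟩ := CC_bd μ k u (i + 1) x
  unfold chi
  rw [abs_le]; constructor <;> nlinarith

theorem sg_meas (u : V) : Measurable (sg μ u) :=
  sgn_meas.comp ((meas_in u).sub_const _)

/-- the basic integrand -/
noncomputable def gg {m : ℕ} (z : Fin m) (k : ℕ) (T : Finset (Fin m)) (i : ℕ) (u : Fin m → V) (x : V) : ℝ :=
  chi μ k (u z) i x * ∏ j ∈ T, sg μ (u j) x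

noncomputable def GG {m : ℕ} (z : Fin m) (k : ℕ) (T : Finset (Fin m)) (i : ℕ) (u : Fin m → V) : ℝ :=
  ∫ x, gg μ z k T i u x ∂μ

variable {m : ℕ} (z : Fin m) (k : ℕ)

theorem gg_meas (T : Finset (Fin m)) (i : ℕ) (u : Fin m → V) : Measurable (gg μ z k T i u) := by
  unfold gg
  exact (chi_meas μ k _ i).mul (Finset.measurable_fun_prod T fun j _ => sg_meas μ (u j))

theorem gg_bd (T : Finset (Fin m)) (i : ℕ) (u : Fin m → V) (x : V) : |gg μ z k T i u x| ≤ 1 := by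
  unfold gg
  rw [abs_mul, Finset.abs_prod]
  exact mul_le_one₀ (chi_bd μ k _ i x) (Finset.prod_nonneg fun _ _ => abs_nonneg _)
    (Finset.prod_le_one (fun _ _ => abs_nonneg _) fun _ _ => abs_sgn _)

theorem gg_intg (T : Finset (Fin m)) (i : ℕ) (u : Fin m → V) : Integrable (gg μ z k T i u) μ :=
  int_bdd μ (gg_meas μ z k T i u) (gg_bd μ z k T i u)

theorem CC_cont (hN : Null μ) (hM : 0 < μ.real Set.univ) (u : Fin m → V) (hu : ∀ i, ‖u i‖ = 1)
    (i : ℕ) : ∀ᵐ x ∂μ, ContinuousWithinAt (fun w : Fin m → V => CC μ k (w z) i x)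
      {u | ∀ i, ‖u i‖ = 1} u := by
  unfold CC
  by_cases h0 : i = 0
  · simp only [if_pos h0]; exact ae_of_all _ fun x => continuousWithinAt_const
  by_cases h1 : i ≤ 2 * k + 1
  · simp only [if_neg h0, if_pos h1]
    have hf := frac k i (by omega) h1
    filter_upwards [ae_ne μ hN (u z) (hu z) (qt μ (u z) ((i : ℝ) / (2 * k + 2)))] with x hx
    have hq : ContinuousWithinAt (fun w : Fin m → V => qt μ (w z) ((i : ℝ) / (2 * k + 2)))
        {u | ∀ i, ‖u i‖ = 1} u :=
      ContinuousWithinAt.comp (f := fun w : Fin m → V => w z) (t := {u : V | ‖u‖ = 1})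
        (g := fun v => qt μ v ((i : ℝ) / (2 * k + 2)))
        (qt_cont μ hN hM _ hf.1 hf.2 (u z) (hu z)) (continuous_apply z).continuousWithinAt
        (fun w hw => hw z)
    have hi : ContinuousWithinAt (fun w : Fin m → V => (inner ℝ x (w z) : ℝ))
        {u | ∀ i, ‖u i‖ = 1} u :=
      (continuous_const.inner (continuous_apply z)).continuousWithinAt
    exact ContinuousAt.comp_continuousWithinAt
      (f := fun w : Fin m → V => qt μ (w z) ((i : ℝ) / (2 * k + 2)) - inner ℝ x (w z))
      (g := Hv) (Hv_cont (by simpa [sub_eq_zero] using Ne.symm hx)) (hq.sub hi)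
  · simp only [if_neg h0, if_neg h1]; exact ae_of_all _ fun x => continuousWithinAt_const

theorem sg_cont (hN : Null μ) (hM : 0 < μ.real Set.univ) (u : Fin m → V) (hu : ∀ i, ‖u i‖ = 1) :
    ∀ᵐ x ∂μ, ContinuousWithinAt (fun w : Fin m → V => sg μ (w z) x)
      {u | ∀ i, ‖u i‖ = 1} u := by
  unfold sg
  filter_upwards [ae_ne μ hN (u z) (hu z) (qt μ (u z) (1 / 2))] with x hx
  have hq : ContinuousWithinAt (fun w : Fin m → V => qt μ (w z) (1 / 2))
      {u | ∀ i, ‖u i‖ = 1} u :=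
    ContinuousWithinAt.comp (f := fun w : Fin m → V => w z) (t := {u : V | ‖u‖ = 1})
      (g := fun v => qt μ v (1 / 2))
      (qt_cont μ hN hM _ (by norm_num) (by norm_num) (u z) (hu z))
      (continuous_apply z).continuousWithinAt (fun w hw => hw z)
  have hi : ContinuousWithinAt (fun w : Fin m → V => (inner ℝ x (w z) : ℝ))
      {u | ∀ i, ‖u i‖ = 1} u :=
    (continuous_const.inner (continuous_apply z)).continuousWithinAt
  exact ContinuousAt.comp_continuousWithinAt
    (f := fun w : Fin m → V => inner ℝ x (w z) - qt μ (w z) (1 / 2))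
    (g := sgn) (sgn_cont (by simpa [sub_eq_zero] using hx)) (hi.sub hq)

theorem GG_cont (hN : Null μ) (hM : 0 < μ.real Set.univ) (T : Finset (Fin m)) (i : ℕ) :
    ContinuousOn (GG μ z k T i) {u | ∀ i, ‖u i‖ = 1} := by
  intro u hu
  unfold GG
  refine continuousWithinAt_of_dominated (bound := fun _ => 1) ?_ ?_ (integrable_const _) ?_
  · exact Eventually.of_forall fun w => (gg_meas μ z k T i w).aestronglyMeasurable
  · exact Eventually.of_forall fun w => ae_of_all _ fun x => gg_bd μ z k T i w x
  · have hs : ∀ᵐ x ∂μ, ∀ j : Fin m, ContinuousWithinAt (fun w : Fin m → V => sg μ (w j) x)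
      {u | ∀ i, ‖u i‖ = 1} u := ae_all_iff.mpr fun j => sg_cont μ j hN hM u hu
    filter_upwards [CC_cont μ z k hN hM u hu i, CC_cont μ z k hN hM u hu (i + 1), hs] with x h1 h2 h3
    unfold gg chi
    exact ((continuousWithinAt_const.sub h1).mul h2).mul (tendsto_finsetProd T fun j _ => h3 j)

theorem GG_flip_z (hN : Null μ) (hM : 0 < μ.real Set.univ) (T : Finset (Fin m)) (hz : z ∉ T)
    (i j : ℕ) (hij : i + j = 2 * k + 1) (u : Fin m → V) (hu : ∀ i, ‖u i‖ = 1) :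
    GG μ z k T i (update u z (- u z)) = GG μ z k T j u := by
  unfold GG gg
  congr 1; ext x
  rw [update_self, chi_flip μ hN hM k (u z) (hu z) i j hij]
  congr 1
  refine Finset.prod_congr rfl fun l hl => ?_
  rw [update_of_ne (by rintro rfl; exact hz hl)]

theorem GG_flip_ne (hN : Null μ) (hM : 0 < μ.real Set.univ) (T : Finset (Fin m))
    (i : ℕ) (u : Fin m → V) (hu : ∀ i, ‖u i‖ = 1) (l : Fin m) (hl : l ≠ z) :
    GG μ z k T i (update u l (- u l)) = if l ∈ T then - GG μ z k T i u else GG μ z k T i u := by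
  unfold GG gg
  rw [update_of_ne hl.symm]
  split_ifs with h
  · rw [← integral_neg]
    congr 1; ext x
    rw [← Finset.mul_prod_erase T _ h, ← Finset.mul_prod_erase T (fun j => sg μ (u j) x) h,
      update_self, sg_flip μ hN hM (u l) (hu l)]
    have : ∏ j ∈ T.erase l, sg μ (update u l (-u l) j) x = ∏ j ∈ T.erase l, sg μ (u j) x :=
      Finset.prod_congr rfl fun j hj => by rw [update_of_ne (Finset.ne_of_mem_erase hj)]
    rw [this]; ring
  · congr 1; ext x
    congr 1
    refine Finset.prod_congr rfl fun j hj => ?_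
    rw [update_of_ne (by rintro rfl; exact h hj)]

/-- test map component -/
noncomputable def FF (S : Finset (Fin m)) (a : ℕ) (u : Fin m → V) : ℝ :=
  GG μ z k (S.erase z) a u + (if z ∈ S then -1 else 1) * GG μ z k (S.erase z) (2 * k + 1 - a) u

theorem FF_cont (hN : Null μ) (hM : 0 < μ.real Set.univ) (S : Finset (Fin m)) (a : ℕ) :
    ContinuousOn (FF μ z k S a) {u | ∀ i, ‖u i‖ = 1} := by
  unfold FF
  exact (GG_cont μ z k hN hM _ a).add (continuousOn_const.mul (GG_cont μ z k hN hM _ _))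

theorem FF_flip (hN : Null μ) (hM : 0 < μ.real Set.univ) (S : Finset (Fin m)) (a : ℕ)
    (ha : a ≤ k) (u : Fin m → V) (hu : ∀ i, ‖u i‖ = 1) (l : Fin m) :
    FF μ z k S a (update u l (- u l)) = if l ∈ S then - FF μ z k S a u else FF μ z k S a u := by
  unfold FF
  by_cases hl : l = z
  · subst hl
    rw [GG_flip_z μ l k hN hM _ (Finset.notMem_erase _ _) a (2 * k + 1 - a) (by omega) u hu,
      GG_flip_z μ l k hN hM _ (Finset.notMem_erase _ _) (2 * k + 1 - a) a (by omega) u hu]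
    split_ifs <;> ring
  · rw [GG_flip_ne μ z k hN hM _ _ u hu l hl, GG_flip_ne μ z k hN hM _ _ u hu l hl]
    have : l ∈ S.erase z ↔ l ∈ S := by simp [hl]
    simp only [this]
    by_cases h : l ∈ S
    · simp only [if_pos h]; ring
    · simp only [if_neg h]

theorem sum_chi (hN : Null μ) (hM : 0 < μ.real Set.univ) (u : V) (hu : ‖u‖ = 1) (x : V) :
    ∑ i ∈ Finset.range (2 * k + 2), chi μ k u i x = 1 := by
  simp only [chi_eq μ hN hM k u hu]
  rw [Finset.sum_range_sub (fun i => CC μ k u i x)]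
  simp [CC]

theorem sum_GG (hN : Null μ) (hM : 0 < μ.real Set.univ) (u : Fin m → V) (hu : ∀ i, ‖u i‖ = 1)
    (j : Fin m) : ∑ i ∈ Finset.range (2 * k + 2), GG μ z k {j} i u = 0 := by
  unfold GG
  rw [← integral_finsetSum _ (fun i _ => gg_intg μ z k {j} i u)]
  unfold gg
  simp only [← Finset.sum_mul, sum_chi μ k hN hM (u z) (hu z), one_mul, Finset.prod_singleton]
  exact sg_integ μ hN hM (u j) (hu j)

/-- vanishing of all correlations -/
theorem GG_zero (hN : Null μ) (hM : 0 < μ.real Set.univ) (u : Fin m → V) (hu : ∀ i, ‖u i‖ = 1)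
    (h1 : ∀ S : Finset (Fin m), 2 ≤ S.card → ∀ a ≤ k, FF μ z k S a u = 0)
    (h2 : ∀ j, j ≠ z → ∀ a < k, FF μ z k {j} a u = 0)
    (T : Finset (Fin m)) (hT : T.Nonempty) (hz : z ∉ T) (i : ℕ) (hi : i ≤ 2 * k + 1) :
    GG μ z k T i u = 0 := by
  have hc : 1 ≤ T.card := hT.card_pos
  -- antisymmetric part
  have hA : ∀ a ≤ k, GG μ z k T a u - GG μ z k T (2 * k + 1 - a) u = 0 := by
    intro a ha
    have h := h1 (insert z T) (by rw [Finset.card_insert_of_notMem hz]; omega) a ha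
    unfold FF at h
    rw [Finset.erase_insert hz, if_pos (Finset.mem_insert_self _ _)] at h
    linarith
  have hB : ∀ a ≤ k, GG μ z k T a u + GG μ z k T (2 * k + 1 - a) u = 0 := by
    by_cases hc2 : 2 ≤ T.card
    · intro a ha
      have h := h1 T hc2 a ha
      unfold FF at h
      rw [Finset.erase_eq_of_notMem hz, if_neg hz] at h
      linarith
    · obtain ⟨j, rfl⟩ := Finset.card_eq_one.mp (by omega : T.card = 1)
      have hj : j ≠ z := by rintro rfl; simp at hz
      have hlt : ∀ a < k, GG μ z k {j} a u + GG μ z k {j} (2 * k + 1 - a) u = 0 := by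
        intro a ha
        have h := h2 j hj a ha
        unfold FF at h
        rw [Finset.erase_eq_of_notMem hz, if_neg hz] at h
        linarith
      have hsum : ∑ a ∈ Finset.range (k + 1), (GG μ z k {j} a u + GG μ z k {j} (2 * k + 1 - a) u) = 0 := by
        rw [← sum_GG μ z k hN hM u hu j, Finset.sum_add_distrib,
          show 2 * k + 2 = (k + 1) + (k + 1) by ring, Finset.sum_range_add _ (k + 1) (k + 1)]
        congr 1
        rw [← Finset.sum_range_reflect (fun x => GG μ z k {j} (k + 1 + x) u) (k + 1)]
        refine Finset.sum_congr rfl fun a ha => ?_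
        have := Finset.mem_range.mp ha
        congr 1; omega
      rw [Finset.sum_range_succ, Finset.sum_eq_zero (fun a ha => hlt a (Finset.mem_range.mp ha)), zero_add] at hsum
      intro a ha
      rcases Nat.lt_or_eq_of_le ha with h | rfl
      · exact hlt a h
      · exact hsum
  by_cases h : i ≤ k
  · have := hA i h; have := hB i h; linarith
  · have h3 := hA (2 * k + 1 - i) (by omega)
    have h4 := hB (2 * k + 1 - i) (by omega)
    rw [show 2 * k + 1 - (2 * k + 1 - i) = i by omega] at h3 h4
    linarith

/-- existence of directions -/
theorem exists_dirs (hd : 1 ≤ d) (hN : Null μ) (hM : 0 < μ.real Set.univ)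
    (hQ : (∏ i ∈ Finset.univ.filter (fun i : Fin m => i ≠ z),
            (MvPolynomial.X i : MvPolynomial (Fin m) (ZMod 2)) ^ k) *
          (∏ S ∈ Finset.univ.filter (fun S : Finset (Fin m) => 2 ≤ S.card),
            ∑ i ∈ S, MvPolynomial.X i) ^ (k + 1) ∉
      Ideal.span (Set.range fun i : Fin m => (MvPolynomial.X i : MvPolynomial (Fin m) (ZMod 2)) ^ d)) :
    ∃ u : Fin m → V, (∀ i, ‖u i‖ = 1) ∧ ∀ T : Finset (Fin m), T.Nonempty → z ∉ T → ∀ i ≤ 2 * k + 1,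
      GG μ z k T i u = 0 := by
  classical
  let SS : ({S : Finset (Fin m) // 2 ≤ S.card} × Fin (k + 1)) ⊕ ({j : Fin m // j ≠ z} × Fin k) →
    Finset (Fin m) := Sum.elim (fun p => p.1.1) (fun p => {p.1.1})
  let AA : ({S : Finset (Fin m) // 2 ≤ S.card} × Fin (k + 1)) ⊕ ({j : Fin m // j ≠ z} × Fin k) →
    ℕ := Sum.elim (fun p => p.2.1) (fun p => p.2.1)
  have hAA : ∀ r, AA r ≤ k := by
    rintro (⟨S, a⟩ | ⟨j, a⟩)
    · exact Nat.lt_succ_iff.mp a.2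
    · exact a.2.le
  have hprod : (∏ r, ∑ i ∈ SS r, (MvPolynomial.X i : MvPolynomial (Fin m) (ZMod 2))) =
      (∏ i ∈ Finset.univ.filter (fun i : Fin m => i ≠ z),
            (MvPolynomial.X i : MvPolynomial (Fin m) (ZMod 2)) ^ k) *
          (∏ S ∈ Finset.univ.filter (fun S : Finset (Fin m) => 2 ≤ S.card),
            ∑ i ∈ S, MvPolynomial.X i) ^ (k + 1) := by
    rw [Fintype.prod_sum_type, Fintype.prod_prod_type, Fintype.prod_prod_type, mul_comm]
    simp only [SS, Sum.elim_inl, Sum.elim_inr, Finset.sum_singleton, Finset.prod_const,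
      Finset.card_univ, Fintype.card_fin]
    rw [Finset.prod_pow (Finset.univ : Finset {S : Finset (Fin m) // 2 ≤ S.card})]
    rw [Finset.prod_subtype (p := fun i : Fin m => i ≠ z) _ (by simp)
        (fun i => (MvPolynomial.X i : MvPolynomial (Fin m) (ZMod 2)) ^ k),
      Finset.prod_subtype (p := fun S : Finset (Fin m) => 2 ≤ S.card) _ (by simp)
        (fun S => ∑ i ∈ S, (MvPolynomial.X i : MvPolynomial (Fin m) (ZMod 2)))]
  obtain ⟨u, hu, h⟩ := BU m d hd SS (fun u r => FF μ z k (SS r) (AA r) u)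
    (continuousOn_pi.mpr fun r => FF_cont μ z k hN hM _ _)
    (fun u hu i r => FF_flip μ z k hN hM (SS r) (AA r) (hAA r) u hu i) (by rw [hprod]; exact hQ)
  refine ⟨u, hu, fun T hT hz i hi => GG_zero μ z k hN hM u hu ?_ ?_ T hT hz i hi⟩
  · intro S hS a ha
    exact h (Sum.inl (⟨S, hS⟩, ⟨a, by omega⟩))
  · intro j hj a ha
    exact h (Sum.inr (⟨j, hj⟩, ⟨a, ha⟩))

end fin

section fin2

open MeasureTheory Function Filter Topology

variable {d : ℕ} (μ : Measure (EuclideanSpace ℝ (Fin d))) [IsFiniteMeasure μ] [μ.IsOpenPosMeasure]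

local notation "V" => EuclideanSpace ℝ (Fin d)

variable {m : ℕ} (z : Fin m) (k : ℕ)

theorem slab_meas (u : V) (t : ℕ → ℝ) (n i : ℕ) : MeasurableSet (slab u t n i) := by
  unfold slab
  refine MeasurableSet.inter (s₁ := {x : V | 1 ≤ i → t i < (inner ℝ x u : ℝ)})
    (s₂ := {x : V | i + 1 ≤ n → (inner ℝ x u : ℝ) < t (i + 1)}) ?_ ?_
  · by_cases h : 1 ≤ i
    · simp only [h, true_imp_iff]; exact measurableSet_lt measurable_const (meas_in u)
    · simp [h]
  · by_cases h : i + 1 ≤ n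
    · simp only [h, true_imp_iff]; exact measurableSet_lt (meas_in u) measurable_const
    · simp [h]

theorem halfSp_meas (u : V) (s : ℝ) (b : Bool) : MeasurableSet (halfSp u s b) := by
  unfold halfSp
  split_ifs
  · exact measurableSet_lt (meas_in u) measurable_const
  · exact measurableSet_lt measurable_const (meas_in u)

/-- sign attached to a side -/
noncomputable def eta (b : Bool) : ℝ := if b then -1 else 1

open Classical in
theorem half_ind (u : V) (b : Bool) (x : V) (hx : (inner ℝ x u : ℝ) ≠ qt μ u (1 / 2)) :
    (1 + eta b * sg μ u x) / 2 = if x ∈ halfSp u (qt μ u (1 / 2)) b then 1 else 0 := by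
  unfold halfSp sg eta
  generalize qt μ u (1 / 2) = q at *
  rcases lt_or_gt_of_ne hx with h | h
  · rw [sgn_of_neg (by linarith)]
    cases b
    · simp [h.le]
    · simp [h]
  · rw [sgn_pos (by linarith)]
    cases b
    · simp [h]
    · simp [h.le]

open Classical in
theorem slab_ind (u : V) (i : ℕ) (hi : i ≤ 2 * k + 1) (x : V)
    (hx : ∀ i : ℕ, (inner ℝ x u : ℝ) ≠ qt μ u ((i : ℝ) / (2 * k + 2))) :
    chi μ k u i x = if x ∈ slab u (fun i => qt μ u ((i : ℝ) / (2 * k + 2))) (2 * k + 1) i then 1 else 0 := by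
  have h1 : 1 - CC μ k u i x = if (1 ≤ i → qt μ u ((i : ℝ) / (2 * k + 2)) < (inner ℝ x u : ℝ)) then 1 else 0 := by
    unfold CC
    by_cases h0 : i = 0
    · simp [h0]
    · rw [if_neg h0, if_pos hi]
      have : 1 ≤ i := by omega
      simp only [this, true_imp_iff]
      rcases lt_or_gt_of_ne (hx i) with h | h
      · rw [Hv_pos (by linarith), if_neg (by linarith)]; ring
      · rw [Hv_of_neg (by linarith), if_pos (by linarith)]; ring
  have h2 : CC μ k u (i + 1) x = if (i + 1 ≤ 2 * k + 1 → (inner ℝ x u : ℝ) < qt μ u (((i + 1 : ℕ) : ℝ) / (2 * k + 2))) then 1 else 0 := by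
    unfold CC
    rw [if_neg (Nat.succ_ne_zero i)]
    by_cases h0 : i + 1 ≤ 2 * k + 1
    · rw [if_pos h0]
      simp only [h0, true_imp_iff]
      rcases lt_or_gt_of_ne (hx (i + 1)) with h | h
      · rw [Hv_pos (by linarith), if_pos (by linarith)]
      · rw [Hv_of_neg (by linarith), if_neg (by linarith)]
    · rw [if_neg h0]; simp [h0]
  unfold chi
  rw [h1, h2]
  unfold slab
  simp only [Set.mem_setOf_eq]
  rw [ite_and]
  split_ifs <;> simp

/-- a box -/
def Reg (u : Fin m → V) (i : ℕ) (ε : Fin m → Bool) : Set V :=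
  slab (u z) (fun i => qt μ (u z) ((i : ℝ) / (2 * k + 2))) (2 * k + 1) i ∩
    ⋂ j ∈ Finset.univ.filter (fun j : Fin m => j ≠ z), halfSp (u j) (qt μ (u j) (1 / 2)) (ε j)

theorem Reg_meas (u : Fin m → V) (i : ℕ) (ε : Fin m → Bool) : MeasurableSet (Reg μ z k u i ε) := by
  unfold Reg
  exact (slab_meas _ _ _ _).inter (Finset.measurableSet_biInter _ fun j _ => halfSp_meas _ _ _)

theorem Reg_real (hN : Null μ) (hM : 0 < μ.real Set.univ) (u : Fin m → V) (hu : ∀ i, ‖u i‖ = 1)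
    (hG : ∀ T : Finset (Fin m), T.Nonempty → z ∉ T → ∀ i ≤ 2 * k + 1, GG μ z k T i u = 0)
    (i : ℕ) (hi : i ≤ 2 * k + 1) (ε : Fin m → Bool) :
    μ.real (Reg μ z k u i ε) = μ.real Set.univ / ((2 ^ (m - 1) * (2 * k + 2) : ℕ) : ℝ) := by
  classical
  set A := Finset.univ.filter (fun j : Fin m => j ≠ z) with hA
  have hcard : A.card = m - 1 := by
    have : A = Finset.univ.erase z := by ext j; simp [hA]
    rw [this, Finset.card_erase_of_mem (Finset.mem_univ _)]; simp
  have e1 : μ.real (Reg μ z k u i ε) = ∫ x, (Reg μ z k u i ε).indicator (fun _ => (1 : ℝ)) x ∂μ := by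
    rw [integral_indicator_const _ (Reg_meas μ z k u i ε)]; simp
  have e2 : ∫ x, (Reg μ z k u i ε).indicator (fun _ => (1 : ℝ)) x ∂μ =
      ∫ x, chi μ k (u z) i x * ∏ j ∈ A, ((1 + eta (ε j) * sg μ (u j) x) / 2) ∂μ := by
    apply integral_congr_ae
    have ha : ∀ᵐ x ∂μ, ∀ i : ℕ, (inner ℝ x (u z) : ℝ) ≠ qt μ (u z) ((i : ℝ) / (2 * k + 2)) :=
      ae_all_iff.mpr fun i => ae_ne μ hN (u z) (hu z) _
    have hb : ∀ᵐ x ∂μ, ∀ j : Fin m, (inner ℝ x (u j) : ℝ) ≠ qt μ (u j) (1 / 2) :=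
      ae_all_iff.mpr fun j => ae_ne μ hN (u j) (hu j) _
    filter_upwards [ha, hb] with x hx hy
    rw [slab_ind μ k (u z) i hi x hx,
      Finset.prod_congr rfl (fun j _ => half_ind μ (u j) (ε j) x (hy j)), Finset.prod_ite_zero]
    unfold Reg
    simp only [Set.indicator_apply, Set.mem_inter_iff, Set.mem_iInter, Finset.prod_const_one]
    rw [ite_and]
    split_ifs <;> simp
  have e3 : ∀ x, chi μ k (u z) i x * ∏ j ∈ A, ((1 + eta (ε j) * sg μ (u j) x) / 2) =
      ((1 : ℝ) / 2 ^ (m - 1)) * ∑ T ∈ A.powerset, (∏ j ∈ T, eta (ε j)) * gg μ z k T i u x := by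
    intro x
    rw [Finset.prod_div_distrib, Finset.prod_const, hcard, Finset.prod_one_add]
    unfold gg
    rw [mul_div_assoc', Finset.mul_sum, div_eq_mul_one_div, mul_comm]
    congr 1
    refine Finset.sum_congr rfl fun T _ => ?_
    rw [Finset.prod_mul_distrib]; ring
  rw [e1, e2]
  simp only [e3]
  rw [integral_const_mul, integral_finsetSum _ (fun T _ => (gg_intg μ z k T i u).const_mul _)]
  have e4 : ∑ T ∈ A.powerset, ∫ x, (∏ j ∈ T, eta (ε j)) * gg μ z k T i u x ∂μ =
      μ.real Set.univ / (2 * k + 2) := by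
    rw [Finset.sum_eq_single ∅]
    · simp only [Finset.prod_empty, one_mul, gg, mul_one]
      exact chi_integ μ hN hM k (u z) (hu z) i hi
    · intro T hT hne
      rw [integral_const_mul]
      have := hG T (Finset.nonempty_iff_ne_empty.mpr hne) (fun hz => by
        have := Finset.mem_powerset.mp hT hz
        simp [hA] at this) i hi
      unfold GG at this
      rw [this, mul_zero]
    · intro h; simp at h
  rw [e4]
  push_cast
  rw [div_mul_div_comm, one_mul]

theorem Reg_measure (hN : Null μ) (hM : 0 < μ.real Set.univ) (u : Fin m → V) (hu : ∀ i, ‖u i‖ = 1)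
    (hG : ∀ T : Finset (Fin m), T.Nonempty → z ∉ T → ∀ i ≤ 2 * k + 1, GG μ z k T i u = 0)
    (i : ℕ) (hi : i ≤ 2 * k + 1) (ε : Fin m → Bool) :
    μ (Reg μ z k u i ε) = μ Set.univ / ((2 ^ (m - 1) * (2 * k + 2) : ℕ) : ENNReal) := by
  have h := Reg_real μ z k hN hM u hu hG i hi ε
  rw [← ofReal_measureReal (μ := μ) (s := Reg μ z k u i ε), h, ENNReal.ofReal_div_of_pos (by positivity),
    ofReal_measureReal, ENNReal.ofReal_natCast]

theorem qt_half_neg (hN : Null μ) (hM : 0 < μ.real Set.univ) (u : V) (hu : ‖u‖ = 1) :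
    qt μ (-u) (1 / 2) = - qt μ u (1 / 2) := by
  have h := qt_neg μ hN hM u hu (1 / 2) (by norm_num) (by norm_num)
  have h2 : (1 : ℝ) - 1 / 2 = 1 / 2 := by norm_num
  rwa [h2] at h

theorem nonpar (hN : Null μ) (hM : 0 < μ.real Set.univ) (u : Fin m → V) (hu : ∀ i, ‖u i‖ = 1)
    (hG : ∀ T : Finset (Fin m), T.Nonempty → z ∉ T → ∀ i ≤ 2 * k + 1, GG μ z k T i u = 0)
    (j l : Fin m) (hjl : j ≠ l) : u j ≠ u l ∧ u j ≠ - u l := by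
  have H : ∀ j l : Fin m, j ≠ l → l ≠ z → ∀ b : Bool, ∃ x : V,
      (inner ℝ x (u j) : ℝ) < qt μ (u j) (1 / 2) ∧ x ∈ halfSp (u l) (qt μ (u l) (1 / 2)) b := by
    intro j l hjl hl b
    have hr := Reg_real μ z k hN hM u hu hG 0 (by omega) (update (fun _ => true) l b)
    have hne : (Reg μ z k u 0 (update (fun _ => true) l b)).Nonempty := by
      rw [Set.nonempty_iff_ne_empty]
      intro h
      rw [h, measureReal_empty] at hr
      have : 0 < μ.real Set.univ / ((2 ^ (m - 1) * (2 * k + 2) : ℕ) : ℝ) := by positivity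
      linarith
    obtain ⟨x, hx1, hx2⟩ := hne
    simp only [Set.mem_iInter, Finset.mem_filter, Finset.mem_univ, true_and] at hx2
    refine ⟨x, ?_, ?_⟩
    · by_cases hj : j = z
      · subst hj
        have h1 := hx1.2 (by omega)
        simp only [zero_add, Nat.cast_one] at h1
        refine lt_of_lt_of_le h1 ?_
        rcases Nat.eq_zero_or_pos k with rfl | hk
        · norm_num
        · refine (qt_lt μ hN hM (u j) (hu j) _ _ (by positivity) (by norm_num) ?_).le
          have : (1 : ℝ) ≤ k := by exact_mod_cast hk
          rw [div_lt_div_iff₀ (by positivity) (by norm_num)]; linarith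
      · have := hx2 j hj
        rw [update_of_ne hjl] at this
        simpa [halfSp] using this
    · have := hx2 l hl
      rwa [update_self] at this
  have K : ∀ j l : Fin m, j ≠ l → l ≠ z → u j ≠ u l ∧ u j ≠ - u l := by
    intro j l hjl hl
    constructor
    · intro h
      obtain ⟨x, h1, h2⟩ := H j l hjl hl false
      simp only [halfSp, Bool.false_eq_true, if_false, Set.mem_setOf_eq] at h2
      rw [h] at h1; linarith
    · intro h
      obtain ⟨x, h1, h2⟩ := H j l hjl hl true
      simp only [halfSp, if_true, Set.mem_setOf_eq] at h2
      rw [h, qt_half_neg μ hN hM (u l) (hu l), inner_neg_right] at h1; linarith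
  by_cases hl : l = z
  · obtain ⟨h1, h2⟩ := K l j hjl.symm (by rw [← hl]; exact hjl)
    refine ⟨h1.symm, fun h => h2 ?_⟩
    rw [h, neg_neg]
  · exact K j l hjl hl

theorem main (hd : 1 ≤ d) (hN : Null μ) (hM : 0 < μ.real Set.univ)
    (hQ : (∏ i ∈ Finset.univ.filter (fun i : Fin m => i ≠ z),
            (MvPolynomial.X i : MvPolynomial (Fin m) (ZMod 2)) ^ k) *
          (∏ S ∈ Finset.univ.filter (fun S : Finset (Fin m) => 2 ≤ S.card),
            ∑ i ∈ S, MvPolynomial.X i) ^ (k + 1) ∉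
      Ideal.span (Set.range fun i : Fin m => (MvPolynomial.X i : MvPolynomial (Fin m) (ZMod 2)) ^ d)) :
    ∃ (u : Fin m → V) (t : ℕ → ℝ) (s : Fin m → ℝ),
      (∀ j, ‖u j‖ = 1) ∧
      (∀ j l, j ≠ l → u j ≠ u l ∧ u j ≠ -u l) ∧
      StrictMonoOn t (Set.Icc 1 (2 * k + 1)) ∧
      ∀ i ≤ 2 * k + 1, ∀ ε : Fin m → Bool,
        μ (slab (u z) t (2 * k + 1) i ∩
            ⋂ j ∈ Finset.univ.filter (fun j : Fin m => j ≠ z),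
              halfSp (u j) (s j) (ε j)) =
          μ Set.univ / ((2 ^ (m - 1) * (2 * k + 2) : ℕ) : ENNReal) := by
  obtain ⟨u, hu, hG⟩ := exists_dirs μ z k hd hN hM hQ
  refine ⟨u, fun i => qt μ (u z) ((i : ℝ) / (2 * k + 2)), fun j => qt μ (u j) (1 / 2), hu,
    nonpar μ z k hN hM u hu hG, ?_, fun i hi ε => Reg_measure μ z k hN hM u hu hG i hi ε⟩
  intro a ha b hb hab
  refine qt_lt μ hN hM (u z) (hu z) _ _ (frac k a ha.1 ha.2).1 (frac k b hb.1 hb.2).2 ?_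
  apply div_lt_div_of_pos_right _ (by positivity)
  exact_mod_cast hab

end fin2

theorem null_of_ac {d : ℕ} (μ : MeasureTheory.Measure (EuclideanSpace ℝ (Fin d)))
    (h : ∀ A : Set (EuclideanSpace ℝ (Fin d)), MeasurableSet A → MeasureTheory.volume A = 0 → μ A = 0) :
    Null μ := by
  intro u hu s
  have hms : MeasurableSet {x : EuclideanSpace ℝ (Fin d) | (inner ℝ x u : ℝ) = s} :=
    meas_in u (measurableSet_singleton s)
  apply h _ hms
  let P : AffineSubspace ℝ (EuclideanSpace ℝ (Fin d)) :=
    (AffineSubspace.mk' (s • u) (LinearMap.ker (innerₗ (EuclideanSpace ℝ (Fin d)) u)))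
  have hP : {x : EuclideanSpace ℝ (Fin d) | (inner ℝ x u : ℝ) = s} = (P : Set _) := by
    ext x
    simp only [P, Set.mem_setOf_eq, SetLike.mem_coe, AffineSubspace.mem_mk', LinearMap.mem_ker,
      innerₗ_apply_apply, vsub_eq_sub, inner_sub_right, inner_smul_right,
      real_inner_self_eq_norm_sq, hu, real_inner_comm u x]
    rw [sub_eq_zero]; simp
  rw [hP]
  apply MeasureTheory.Measure.addHaar_affineSubspace
  intro ht
  have h1 : (s + 1) • u ∈ P := by rw [ht]; trivial
  have h2 : (s + 1) • u ∈ {x : EuclideanSpace ℝ (Fin d) | (inner ℝ x u : ℝ) = s} := by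
    rw [hP]; exact h1
  simp only [Set.mem_setOf_eq, inner_smul_left, real_inner_self_eq_norm_sq, hu] at h2
  simp at h2

end EqP

open MvPolynomial Finset in
/-- The general odd case: if
`(1/(x₂⋯x_m))·(𝔓_m/x₁)^(k+1) ∉ (x₁^d, …, x_m^d)` in `(ℤ/2)[x₁,…,x_m]`, then
every mass distribution in `ℝ^d` admits an equipartition into `(2k+2)×2×⋯×2`
boxes by `2k+1` parallel hyperplanes and `m-1` additional pairwise
non-parallel hyperplanes. -/
theorem equipartition_general_odd (m k d : ℕ) (hm : 2 ≤ m) (hd : 2 ≤ d)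
    (hQ : (∏ i ∈ univ.filter (fun i : Fin m => i ≠ ⟨0, by omega⟩),
            (X i : MvPolynomial (Fin m) (ZMod 2)) ^ k) *
          (∏ S ∈ univ.filter (fun S : Finset (Fin m) => 2 ≤ S.card),
            ∑ i ∈ S, X i) ^ (k + 1) ∉
      Ideal.span (Set.range fun i : Fin m => (X i : MvPolynomial (Fin m) (ZMod 2)) ^ d))
    (μ : Measure (EuclideanSpace ℝ (Fin d)))
    (f : EuclideanSpace ℝ (Fin d) → ℝ) (hf : Integrable f)
    (hμ : ∀ A : Set (EuclideanSpace ℝ (Fin d)), MeasurableSet A →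
      μ A = ENNReal.ofReal (∫ x in A, f x))
    (hpos : ∀ U : Set (EuclideanSpace ℝ (Fin d)), IsOpen U → U.Nonempty → 0 < μ U) :
    ∃ (u : Fin m → EuclideanSpace ℝ (Fin d)) (t : ℕ → ℝ) (s : Fin m → ℝ),
      (∀ j, ‖u j‖ = 1) ∧
      (∀ j l, j ≠ l → u j ≠ u l ∧ u j ≠ -u l) ∧
      StrictMonoOn t (Set.Icc 1 (2 * k + 1)) ∧
      ∀ i ≤ 2 * k + 1, ∀ ε : Fin m → Bool,
        μ (slab (u ⟨0, by omega⟩) t (2 * k + 1) i ∩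
            ⋂ j ∈ univ.filter (fun j : Fin m => j ≠ ⟨0, by omega⟩),
              halfSp (u j) (s j) (ε j)) =
          μ Set.univ / ((2 ^ (m - 1) * (2 * k + 2) : ℕ) : ENNReal) := by
  have hfin : IsFiniteMeasure μ := ⟨by rw [hμ _ MeasurableSet.univ]; exact ENNReal.ofReal_lt_top⟩
  have hop : μ.IsOpenPosMeasure := ⟨fun U hU hne => (hpos U hU hne).ne'⟩
  have hM : 0 < μ.real Set.univ :=
    ENNReal.toReal_pos (hpos _ isOpen_univ Set.univ_nonempty).ne' (measure_ne_top μ _)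
  have hN : EqP.Null μ := EqP.null_of_ac μ fun A hA h0 => by
    rw [hμ A hA, Measure.restrict_eq_zero.mpr h0]; simp
  exact EqP.main μ (⟨0, by omega⟩ : Fin m) k (by omega) hN hM hQ
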